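/- arXiv:2008.10883 — 9 statements merged into one kernel-verified Lean document; each statement's English description precedes it below -/
import Mathlib

section
/- Let 0 ≤ t < a and let y : [t, a] → ℝ be continuous. Define F(x) := ∫_x^a y(s)·x/√(s² − x²) ds for x ∈ [t, a]. Then ∫_t^a F(x)/√(x² − t²) dx = (π/2)·∫_t^a y(s) ds. -/
open MeasureTheory

/-- The Abel kernel in the variable `s`. -/
theorem intervalIntegrable_inv_sqrt_sq_sub_sq {x a : ℝ} (hx : 0 < x) (hxa : x ≤ a) :
    IntervalIntegrable (fun s => 1 / Real.sqrt (s ^ 2 - x ^ 2)) volume x a := by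
  have hpos : ∀ s ∈ Set.Icc x a, s + Real.sqrt (s ^ 2 - x ^ 2) ≠ 0 := fun s hs => by
    have := Real.sqrt_nonneg (s ^ 2 - x ^ 2)
    exact (by linarith [hs.1] : (0 : ℝ) < _).ne'
  refine intervalIntegral.intervalIntegrable_deriv_of_nonneg
    (g := fun s => Real.log (s + Real.sqrt (s ^ 2 - x ^ 2))) ?_ ?_ ?_
  · rw [Set.uIcc_of_le hxa]
    exact ContinuousOn.log (by fun_prop) hpos
  · rw [min_eq_left hxa, max_eq_right hxa]
    intro s hs
    have hd : 0 < s ^ 2 - x ^ 2 := by nlinarith [hs.1]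
    have hr := Real.sqrt_pos.2 hd
    have h := (((hasDerivAt_id' s).fun_add
      (((hasDerivAt_pow 2 s).sub_const (x ^ 2)).sqrt hd.ne')).log
        (hpos s ⟨hs.1.le, hs.2.le⟩))
    convert h using 1
    have := hpos s ⟨hs.1.le, hs.2.le⟩
    field_simp
    push_cast
    ring
  · intro s _
    positivity

theorem abel_kernel_integral {t s : ℝ} (ht : 0 ≤ t) (hts : t < s) :
    IntervalIntegrable (fun x => x / (Real.sqrt (s ^ 2 - x ^ 2) * Real.sqrt (x ^ 2 - t ^ 2)))
      volume t s ∧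
    ∫ x in t..s, x / (Real.sqrt (s ^ 2 - x ^ 2) * Real.sqrt (x ^ 2 - t ^ 2)) = Real.pi / 2 := by
  have hD : 0 < s ^ 2 - t ^ 2 := by nlinarith
  let g : ℝ → ℝ := fun x => 1 / 2 * Real.arcsin ((2 * x ^ 2 - s ^ 2 - t ^ 2) / (s ^ 2 - t ^ 2))
  have hg : Continuous g :=
    continuous_const.mul (Real.continuous_arcsin.comp (by fun_prop))
  have hderiv : ∀ x ∈ Set.Ioo t s, HasDerivAt g
      (x / (Real.sqrt (s ^ 2 - x ^ 2) * Real.sqrt (x ^ 2 - t ^ 2))) x := by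
    intro x hx
    have h1 : 0 < s ^ 2 - x ^ 2 := by nlinarith [hx.1, hx.2]
    have h2 : 0 < x ^ 2 - t ^ 2 := by nlinarith [hx.1, hx.2]
    have r1 := Real.sqrt_pos.2 h1
    have r2 := Real.sqrt_pos.2 h2
    have hw : HasDerivAt (fun x : ℝ => (2 * x ^ 2 - s ^ 2 - t ^ 2) / (s ^ 2 - t ^ 2))
        (4 * x / (s ^ 2 - t ^ 2)) x := by
      have h := ((((hasDerivAt_pow 2 x).const_mul 2).sub_const (s ^ 2)).sub_const
        (t ^ 2)).div_const (s ^ 2 - t ^ 2)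
      refine h.congr_deriv ?_
      push_cast
      ring
    have hne1 : (2 * x ^ 2 - s ^ 2 - t ^ 2) / (s ^ 2 - t ^ 2) ≠ -1 := by
      rw [Ne, div_eq_iff hD.ne']
      intro h
      linarith
    have hne2 : (2 * x ^ 2 - s ^ 2 - t ^ 2) / (s ^ 2 - t ^ 2) ≠ 1 := by
      rw [Ne, div_eq_iff hD.ne']
      intro h
      linarith
    have hsq : Real.sqrt (1 - ((2 * x ^ 2 - s ^ 2 - t ^ 2) / (s ^ 2 - t ^ 2)) ^ 2) =
        2 * (Real.sqrt (s ^ 2 - x ^ 2) * Real.sqrt (x ^ 2 - t ^ 2)) / (s ^ 2 - t ^ 2) := by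
      rw [Real.sqrt_eq_iff_mul_self_eq_of_pos (by positivity)]
      have e1 := Real.sq_sqrt h1.le
      have e2 := Real.sq_sqrt h2.le
      calc _ = 4 * (Real.sqrt (s ^ 2 - x ^ 2) ^ 2 * Real.sqrt (x ^ 2 - t ^ 2) ^ 2) /
            (s ^ 2 - t ^ 2) ^ 2 := by
            rw [div_mul_div_comm]
            ring
        _ = _ := by
          rw [e1, e2]
          field_simp
          ring
    have h := ((Real.hasDerivAt_arcsin hne1 hne2).comp x hw).const_mul (1 / 2)
    rw [hsq] at h
    refine h.congr_deriv ?_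
    field_simp
    ring
  have hint : IntervalIntegrable
      (fun x => x / (Real.sqrt (s ^ 2 - x ^ 2) * Real.sqrt (x ^ 2 - t ^ 2))) volume t s := by
    refine intervalIntegral.intervalIntegrable_deriv_of_nonneg hg.continuousOn ?_ ?_
    · rwa [min_eq_left hts.le, max_eq_right hts.le]
    · rw [min_eq_left hts.le, max_eq_right hts.le]
      intro x hx
      have := ht.trans hx.1.le
      positivity
  refine ⟨hint, ?_⟩
  rw [intervalIntegral.integral_eq_sub_of_hasDerivAt_of_le hts.le hg.continuousOn hderiv hint]
  have e1 : (2 * s ^ 2 - s ^ 2 - t ^ 2) / (s ^ 2 - t ^ 2) = 1 := by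
    rw [div_eq_one_iff_eq hD.ne']; ring
  have e2 : (2 * t ^ 2 - s ^ 2 - t ^ 2) / (s ^ 2 - t ^ 2) = -1 := by
    rw [div_eq_iff hD.ne']; ring
  simp only [g, e1, e2, Real.arcsin_one, Real.arcsin_neg_one]
  ring

theorem sqrt_sq_sub_sq_eq_zero {s x : ℝ} (hs : 0 ≤ s) (hsx : s ≤ x) :
    Real.sqrt (s ^ 2 - x ^ 2) = 0 :=
  Real.sqrt_eq_zero_of_nonpos (by nlinarith)

theorem abel_kernel_setIntegral {t s a : ℝ} (ht : 0 ≤ t) (hts : t < s) (hsa : s < a) :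
    IntegrableOn (fun x => x / (Real.sqrt (s ^ 2 - x ^ 2) * Real.sqrt (x ^ 2 - t ^ 2)))
      (Set.Ioo t a) ∧
    ∫ x in Set.Ioo t a, x / (Real.sqrt (s ^ 2 - x ^ 2) * Real.sqrt (x ^ 2 - t ^ 2)) =
      Real.pi / 2 := by
  obtain ⟨hi, he⟩ := abel_kernel_integral ht hts
  have hsub : Set.Ioc t s ⊆ Set.Ioo t a := fun x hx => ⟨hx.1, hx.2.trans_lt hsa⟩
  have hzero : ∀ x ∈ Set.Ioo t a \ Set.Ioc t s,
      x / (Real.sqrt (s ^ 2 - x ^ 2) * Real.sqrt (x ^ 2 - t ^ 2)) = 0 := by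
    intro x hx
    have hsx : s ≤ x := by
      by_contra! h
      exact hx.2 ⟨hx.1.1, h.le⟩
    simp [sqrt_sq_sub_sq_eq_zero (ht.trans hts.le) hsx]
  rw [intervalIntegrable_iff_integrableOn_Ioc_of_le hts.le] at hi
  rw [intervalIntegral.integral_of_le hts.le] at he
  exact ⟨hi.of_forall_sdiff_eq_zero measurableSet_Ioo hzero,
    (setIntegral_eq_of_subset_of_forall_sdiff_eq_zero measurableSet_Ioo hsub hzero).trans he⟩

/-- Abel-type identity: for `0 ≤ t < a` and `y` continuous on `[t, a]`, with
`F x = ∫_x^a y s · x / √(s² − x²) ds`, one has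
`∫_t^a F x / √(x² − t²) dx = (π/2) · ∫_t^a y s ds`. -/
theorem stmt_1 (t a : ℝ) (ht : 0 ≤ t) (hta : t < a) (y : ℝ → ℝ)
    (hy : ContinuousOn y (Set.Icc t a)) :
    (∀ x ∈ Set.Ico t a,
      IntervalIntegrable (fun s => y s * x / Real.sqrt (s ^ 2 - x ^ 2)) volume x a) ∧
    IntegrableOn
      (fun x => (∫ s in x..a, y s * x / Real.sqrt (s ^ 2 - x ^ 2)) / Real.sqrt (x ^ 2 - t ^ 2))
      (Set.Ioo t a) ∧
    ∫ x in Set.Ioo t a,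
        (∫ s in x..a, y s * x / Real.sqrt (s ^ 2 - x ^ 2)) / Real.sqrt (x ^ 2 - t ^ 2) =
      Real.pi / 2 * ∫ s in t..a, y s := by
  have hyi : IntegrableOn y (Set.Ioo t a) :=
    (hy.integrableOn_Icc).mono_set Set.Ioo_subset_Icc_self
  refine ⟨fun x hx => ?_, ?_⟩
  · rcases (ht.trans hx.1).eq_or_lt with rfl | hx0
    · simp
    · have hyx : ContinuousOn (fun s => y s * x) (Set.uIcc x a) := by
        rw [Set.uIcc_of_le hx.2.le]
        exact (hy.mono (Set.Icc_subset_Icc_left hx.1)).mul continuousOn_const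
      refine ((intervalIntegrable_inv_sqrt_sq_sub_sq hx0 hx.2.le).continuousOn_mul hyx).congr ?_
      intro s _
      simp only [mul_one_div]
  let μ : Measure ℝ := volume.restrict (Set.Ioo t a)
  let k : ℝ → ℝ → ℝ := fun s x => x / (Real.sqrt (s ^ 2 - x ^ 2) * Real.sqrt (x ^ 2 - t ^ 2))
  have hk0 : ∀ s, ∀ x ∈ Set.Ioo t a, 0 ≤ k s x := fun s x hx => by
    have := ht.trans hx.1.le
    positivity
  have hprod : Integrable (fun p : ℝ × ℝ => y p.2 * k p.2 p.1) (μ.prod μ) := by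
    have hm : AEStronglyMeasurable (fun p : ℝ × ℝ => y p.2 * k p.2 p.1) (μ.prod μ) := by
      refine (hyi.aestronglyMeasurable.comp_snd (μ := μ)).mul (Measurable.aestronglyMeasurable ?_)
      fun_prop
    rw [integrable_prod_iff' hm]
    constructor
    · filter_upwards [ae_restrict_mem measurableSet_Ioo] with s hs
      exact (abel_kernel_setIntegral ht hs.1 hs.2).1.const_mul (y s)
    · refine (hyi.norm.mul_const (Real.pi / 2)).congr ?_
      filter_upwards [ae_restrict_mem measurableSet_Ioo] with s hs
      rw [← (abel_kernel_setIntegral ht hs.1 hs.2).2, ← integral_const_mul]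
      refine setIntegral_congr_fun measurableSet_Ioo fun x hx => ?_
      simp only [norm_mul]
      rw [Real.norm_of_nonneg (hk0 s x hx)]
  have hF : ∀ x ∈ Set.Ioo t a, ∫ s, y s * k s x ∂μ =
      (∫ s in x..a, y s * x / Real.sqrt (s ^ 2 - x ^ 2)) / Real.sqrt (x ^ 2 - t ^ 2) := by
    intro x hx
    rw [intervalIntegral.integral_of_le hx.2.le, integral_Ioc_eq_integral_Ioo,
      ← integral_div]
    refine (setIntegral_eq_of_subset_of_forall_sdiff_eq_zero (s := Set.Ioo x a)
      measurableSet_Ioo (Set.Ioo_subset_Ioo_left hx.1.le) ?_).trans ?_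
    · intro s hs
      have hsx : s ≤ x := by
        by_contra! h
        exact hs.2 ⟨h, hs.1.2⟩
      simp [k, sqrt_sq_sub_sq_eq_zero (ht.trans hs.1.1.le) hsx]
    · congr 1
      ext s
      simp only [k, mul_div_assoc, div_div]
  have hFae : (fun x => ∫ s, y s * k s x ∂μ) =ᵐ[μ] fun x =>
      (∫ s in x..a, y s * x / Real.sqrt (s ^ 2 - x ^ 2)) / Real.sqrt (x ^ 2 - t ^ 2) := by
    filter_upwards [ae_restrict_mem measurableSet_Ioo] with x hx using hF x hx
  refine ⟨hprod.integral_prod_left.congr hFae, ?_⟩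
  rw [← integral_congr_ae hFae, integral_integral_swap hprod,
    intervalIntegral.integral_of_le hta.le, integral_Ioc_eq_integral_Ioo, ← integral_const_mul]
  refine setIntegral_congr_fun measurableSet_Ioo fun s hs => ?_
  simp only [integral_const_mul]
  rw [mul_comm, ← (abel_kernel_setIntegral ht hs.1 hs.2).2]
end

section
/- Let 0 < b < a and let y : [b, a] → ℝ be continuous. Define F(x) := ∫_x^a y(s)·x/√(s² − x²) ds for x ∈ [b, a]. Then for every t ∈ (b, a), the function t ↦ ∫_t^a F(x)/√(x² − t²) dx is differentiable at t and y(t) = −(2/π)·(d/dt) ∫_t^a F(x)/√(x² − t²) dx. -/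
open MeasureTheory

open Set Real in
lemma abelKernel_hasDerivAt {u s x : ℝ} (hu : 0 ≤ u) (hux : u < x) (hxs : x < s) :
    HasDerivAt (fun x => arcsin ((2 * x ^ 2 - s ^ 2 - u ^ 2) / (s ^ 2 - u ^ 2)) / 2)
      (x / √(s ^ 2 - x ^ 2) / √(x ^ 2 - u ^ 2)) x := by
  have h1 : 0 < s ^ 2 - x ^ 2 := by nlinarith
  have h2 : 0 < x ^ 2 - u ^ 2 := by nlinarith
  have h3 : 0 < s ^ 2 - u ^ 2 := by linarith
  set z := (2 * x ^ 2 - s ^ 2 - u ^ 2) / (s ^ 2 - u ^ 2) with hz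
  have hz1 : -1 < z := by rw [hz, lt_div_iff₀ h3]; linarith
  have hz2 : z < 1 := by rw [hz, div_lt_one h3]; linarith
  have hsq : √(1 - z ^ 2) = 2 * √(s ^ 2 - x ^ 2) * √(x ^ 2 - u ^ 2) / (s ^ 2 - u ^ 2) := by
    rw [sqrt_eq_iff_mul_self_eq (by nlinarith) (by positivity)]
    have e1 := sq_sqrt h1.le
    have e2 := sq_sqrt h2.le
    symm
    calc _ = 4 * √(s ^ 2 - x ^ 2) ^ 2 * √(x ^ 2 - u ^ 2) ^ 2 / (s ^ 2 - u ^ 2) ^ 2 := by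
          field_simp; ring
      _ = 1 - z ^ 2 := by rw [e1, e2, hz]; field_simp; ring
  have hin : HasDerivAt (fun x : ℝ => (2 * x ^ 2 - s ^ 2 - u ^ 2) / (s ^ 2 - u ^ 2))
      (4 * x / (s ^ 2 - u ^ 2)) x := by
    have h := (((((hasDerivAt_id x).pow 2).const_mul 2).sub_const (s ^ 2)).sub_const
      (u ^ 2)).div_const (s ^ 2 - u ^ 2)
    refine h.congr_deriv ?_
    simp only [id]; push_cast; ring
  have h := ((hasDerivAt_arcsin hz1.ne' hz2.ne).comp x hin).div_const 2
  refine h.congr_deriv ?_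
  have p1 := sqrt_pos.2 h1
  have p2 := sqrt_pos.2 h2
  rw [hsq]
  field_simp
  ring

open Set Real in
lemma abelKernel_nonneg {u x : ℝ} (s : ℝ) (hx : 0 ≤ x) :
    0 ≤ x / √(s ^ 2 - x ^ 2) / √(x ^ 2 - u ^ 2) := by positivity

open Set Real in
lemma abelKernel_eq_zero {u s x : ℝ} (hs : 0 ≤ s) (hsx : s ≤ x) :
    x / √(s ^ 2 - x ^ 2) / √(x ^ 2 - u ^ 2) = 0 := by
  rw [sqrt_eq_zero_of_nonpos (by nlinarith : s ^ 2 - x ^ 2 ≤ 0)]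
  simp

open Set Real in
lemma integrableOn_abelKernel {u s : ℝ} (a : ℝ) (hu : 0 ≤ u) (hus : u < s) :
    IntegrableOn (fun x => x / √(s ^ 2 - x ^ 2) / √(x ^ 2 - u ^ 2)) (Ioc u a) := by
  have h : IntegrableOn (fun x => x / √(s ^ 2 - x ^ 2) / √(x ^ 2 - u ^ 2)) (Ioc u s) :=
    intervalIntegral.integrableOn_deriv_of_nonneg
      (g := fun x => arcsin ((2 * x ^ 2 - s ^ 2 - u ^ 2) / (s ^ 2 - u ^ 2)) / 2)
      (by fun_prop) (fun x hx => abelKernel_hasDerivAt hu hx.1 hx.2)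
      (fun x hx => abelKernel_nonneg s (hu.trans hx.1.le))
  refine h.of_forall_sdiff_eq_zero measurableSet_Ioc fun x hx => ?_
  exact abelKernel_eq_zero (hu.trans hus.le) (not_le.1 fun hxs => hx.2 ⟨hx.1.1, hxs⟩).le

open Set Real in
lemma setIntegral_abelKernel {u s a : ℝ} (hu : 0 ≤ u) (hus : u < s) (hsa : s ≤ a) :
    ∫ x in Ioc u a, x / √(s ^ 2 - x ^ 2) / √(x ^ 2 - u ^ 2) = π / 2 := by
  have hne : s ^ 2 - u ^ 2 ≠ 0 := by nlinarith
  rw [setIntegral_eq_of_subset_of_forall_sdiff_eq_zero measurableSet_Ioc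
    (Ioc_subset_Ioc_right hsa) fun x hx => abelKernel_eq_zero (hu.trans hus.le)
      (not_le.1 fun hxs => hx.2 ⟨hx.1.1, hxs⟩).le,
    ← intervalIntegral.integral_of_le hus.le,
    intervalIntegral.integral_eq_sub_of_hasDerivAt_of_le hus.le
      (f := fun x => arcsin ((2 * x ^ 2 - s ^ 2 - u ^ 2) / (s ^ 2 - u ^ 2)) / 2)
      (by fun_prop) (fun x hx => abelKernel_hasDerivAt hu hx.1 hx.2)
      ((intervalIntegrable_iff_integrableOn_Ioc_of_le hus.le).2
        (integrableOn_abelKernel s hu hus))]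
  have e1 : (2 * s ^ 2 - s ^ 2 - u ^ 2) / (s ^ 2 - u ^ 2) = 1 := by
    rw [div_eq_one_iff_eq hne]; ring
  have e2 : (2 * u ^ 2 - s ^ 2 - u ^ 2) / (s ^ 2 - u ^ 2) = -1 := by
    rw [div_eq_iff hne]; ring
  rw [e1, e2, arcsin_one, arcsin_neg_one]
  ring

open Set Real in
lemma integrable_abelKernel_prod {u a : ℝ} (hu : 0 ≤ u) {y : ℝ → ℝ} (hy : Continuous y) :
    Integrable
      (fun p : ℝ × ℝ => y p.2 * (p.1 / √(p.2 ^ 2 - p.1 ^ 2) / √(p.1 ^ 2 - u ^ 2)))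
      ((volume.restrict (Ioc u a)).prod (volume.restrict (Ioc u a))) := by
  have hm : Measurable fun p : ℝ × ℝ =>
      y p.2 * (p.1 / √(p.2 ^ 2 - p.1 ^ 2) / √(p.1 ^ 2 - u ^ 2)) := by
    have := hy.measurable
    fun_prop
  rw [integrable_prod_iff' hm.aestronglyMeasurable]
  refine ⟨?_, ?_⟩
  · filter_upwards [ae_restrict_mem measurableSet_Ioc] with s hs
    exact (integrableOn_abelKernel a hu hs.1).const_mul (y s)
  · have hi : IntegrableOn (fun s => |y s| * (π / 2)) (Ioc u a) :=
      ((hy.abs.mul continuous_const).integrableOn_Icc).mono_set Ioc_subset_Icc_self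
    refine hi.congr ?_
    filter_upwards [ae_restrict_mem measurableSet_Ioc] with s hs
    rw [← setIntegral_abelKernel hu hs.1 hs.2, ← integral_const_mul]
    refine setIntegral_congr_fun measurableSet_Ioc fun x hx => ?_
    simp only [norm_mul, norm_eq_abs]
    rw [abs_of_nonneg (abelKernel_nonneg s (hu.trans hx.1.le))]

open Set Real in
/-- Composing the Abel transform with its adjoint kernel is, up to `π / 2`, integration. -/
lemma integral_abelTransform {u a : ℝ} (hu : 0 ≤ u) (hua : u ≤ a) {y : ℝ → ℝ}
    (hy : Continuous y) :
    ∫ x in u..a, (∫ s in x..a, y s * x / √(s ^ 2 - x ^ 2)) / √(x ^ 2 - u ^ 2) =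
      π / 2 * ∫ s in u..a, y s := by
  rw [intervalIntegral.integral_of_le hua, intervalIntegral.integral_of_le hua]
  calc _ = ∫ x in Ioc u a, ∫ s in Ioc u a,
        y s * (x / √(s ^ 2 - x ^ 2) / √(x ^ 2 - u ^ 2)) := by
        refine setIntegral_congr_fun measurableSet_Ioc fun x hx => ?_
        rw [intervalIntegral.integral_of_le hx.2, ← integral_div,
          setIntegral_eq_of_subset_of_forall_sdiff_eq_zero measurableSet_Ioc
            (Ioc_subset_Ioc_left hx.1.le)]
        · refine setIntegral_congr_fun measurableSet_Ioc fun s _ => ?_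
          ring
        · intro s hs
          rw [abelKernel_eq_zero (hu.trans hs.1.1.le)
            (not_lt.1 fun hxs => hs.2 ⟨hxs, hs.1.2⟩), mul_zero]
    _ = ∫ s in Ioc u a, ∫ x in Ioc u a,
        y s * (x / √(s ^ 2 - x ^ 2) / √(x ^ 2 - u ^ 2)) :=
        integral_integral_swap (integrable_abelKernel_prod hu hy)
    _ = ∫ s in Ioc u a, π / 2 * y s := by
        refine setIntegral_congr_fun measurableSet_Ioc fun s hs => ?_
        rw [integral_const_mul, setIntegral_abelKernel hu hs.1 hs.2, mul_comm]
    _ = _ := integral_const_mul _ _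

open Set Real in
lemma hasDerivAt_integral_abelTransform {b a t : ℝ} (hb : 0 ≤ b) {y : ℝ → ℝ}
    (hy : ContinuousOn y (Icc b a)) (ht : t ∈ Ioo b a) :
    HasDerivAt (fun u => ∫ x in u..a,
      (∫ s in x..a, y s * x / √(s ^ 2 - x ^ 2)) / √(x ^ 2 - u ^ 2)) (-(π / 2) * y t) t := by
  have hba : b ≤ a := (ht.1.trans ht.2).le
  set g := IccExtend hba ((Icc b a).domRestrict y) with hg
  have hgc : Continuous g := (continuousOn_iff_continuous_domRestrict.1 hy).Icc_extend'
  have hgy : ∀ s ∈ Icc b a, g s = y s := fun s hs => IccExtend_of_mem hba _ hs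
  have hd : HasDerivAt (fun u => π / 2 * ∫ s in u..a, g s) (-(π / 2) * y t) t := by
    have h := (intervalIntegral.integral_hasDerivAt_left (hgc.intervalIntegrable t a)
      hgc.aestronglyMeasurable.stronglyMeasurableAtFilter hgc.continuousAt).const_mul (π / 2)
    refine h.congr_deriv ?_
    rw [hgy t (Ioo_subset_Icc_self ht)]
    ring
  refine hd.congr_of_eventuallyEq ?_
  filter_upwards [Ioo_mem_nhds ht.1 ht.2] with u hu
  rw [← integral_abelTransform (hb.trans hu.1.le) hu.2.le hgc]
  refine intervalIntegral.integral_congr fun x hx => ?_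
  rw [uIcc_of_le hu.2.le] at hx
  congr 1
  refine intervalIntegral.integral_congr fun s hs => ?_
  rw [uIcc_of_le hx.2] at hs
  rw [hgy s ⟨hu.1.le.trans (hx.1.trans hs.1), hs.2⟩]

/-- Abel inversion formula on a finite interval: for `0 < b < a`, `y` continuous on `[b, a]`,
and `F x = ∫_x^a y s · x / √(s² − x²) ds`, for every `t ∈ (b, a)` the function
`t ↦ ∫_t^a F x / √(x² − t²) dx` is differentiable at `t` and
`y t = −(2/π) · d/dt ∫_t^a F x / √(x² − t²) dx`. -/
theorem stmt_2 (b a : ℝ) (hb : 0 < b) (hba : b < a) (y : ℝ → ℝ)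
    (hy : ContinuousOn y (Set.Icc b a)) :
    ∀ t ∈ Set.Ioo b a,
      DifferentiableAt ℝ
        (fun u => ∫ x in u..a,
          (∫ s in x..a, y s * x / Real.sqrt (s ^ 2 - x ^ 2)) / Real.sqrt (x ^ 2 - u ^ 2)) t ∧
      y t = -(2 / Real.pi) *
        deriv (fun u => ∫ x in u..a,
          (∫ s in x..a, y s * x / Real.sqrt (s ^ 2 - x ^ 2)) / Real.sqrt (x ^ 2 - u ^ 2)) t := by
  intro t ht
  have h := hasDerivAt_integral_abelTransform hb.le hy ht
  refine ⟨h.differentiableAt, ?_⟩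
  rw [h.deriv]
  field_simp
end

section
/- Let b > 0, δ > 0, C > 0, and let y : [b, ∞) → ℝ be continuous with |y(s)| ≤ C·s^{−1−δ} for all s ≥ b. Define F(x) := ∫_x^∞ y(s)·x/√(s² − x²) ds for x ≥ b (the integral converges absolutely). Then for every t > b: (i) ∫_t^∞ F(x)/√(x² − t²) dx = (π/2)·∫_t^∞ y(s) ds, and (ii) y(t) = −(2/π)·(d/dt) ∫_t^∞ F(x)/√(x² − t²) dx. -/
open MeasureTheory
open Set Filter Topology

/-- The kernel `x ↦ x / √(s² - x²) / √(x² - t²)` is the derivative of an arcsine on `(t, s)`. -/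
lemma hasDerivAt_half_arcsin_kernel {t s x : ℝ} (ht : 0 < t) (hx : x ∈ Ioo t s) :
    HasDerivAt (fun x => Real.arcsin ((2 * x ^ 2 - s ^ 2 - t ^ 2) / (s ^ 2 - t ^ 2)) / 2)
      (x / √(s ^ 2 - x ^ 2) / √(x ^ 2 - t ^ 2)) x := by
  obtain ⟨htx, hxs⟩ := hx
  have h1 : 0 < s ^ 2 - x ^ 2 := by nlinarith
  have h2 : 0 < x ^ 2 - t ^ 2 := by nlinarith
  have h3 : 0 < s ^ 2 - t ^ 2 := by linarith
  have hlin : HasDerivAt (fun x : ℝ => (2 * x ^ 2 - s ^ 2 - t ^ 2) / (s ^ 2 - t ^ 2))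
      (4 * x / (s ^ 2 - t ^ 2)) x := by
    have := ((((hasDerivAt_pow 2 x).const_mul 2).sub_const (s ^ 2)).sub_const (t ^ 2)).div_const
      (s ^ 2 - t ^ 2)
    convert! this using 1
    push_cast
    ring
  have hne1 : (2 * x ^ 2 - s ^ 2 - t ^ 2) / (s ^ 2 - t ^ 2) ≠ -1 := by
    rw [Ne, div_eq_iff h3.ne']; intro h; linarith
  have hne2 : (2 * x ^ 2 - s ^ 2 - t ^ 2) / (s ^ 2 - t ^ 2) ≠ 1 := by
    rw [Ne, div_eq_iff h3.ne']; intro h; linarith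
  have hsq : 1 - ((2 * x ^ 2 - s ^ 2 - t ^ 2) / (s ^ 2 - t ^ 2)) ^ 2 =
      (2 * (√(s ^ 2 - x ^ 2) * √(x ^ 2 - t ^ 2)) / (s ^ 2 - t ^ 2)) ^ 2 := by
    rw [div_pow, div_pow, mul_pow, mul_pow, Real.sq_sqrt h1.le, Real.sq_sqrt h2.le]
    field_simp
    ring
  have hp1 := Real.sqrt_pos.2 h1
  have hp2 := Real.sqrt_pos.2 h2
  convert! ((Real.hasDerivAt_arcsin hne1 hne2).comp x hlin).div_const 2 using 1
  rw [hsq, Real.sqrt_sq (by positivity)]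
  field_simp
  norm_num

lemma continuousOn_half_arcsin_kernel (t s : ℝ) (S : Set ℝ) :
    ContinuousOn (fun x => Real.arcsin ((2 * x ^ 2 - s ^ 2 - t ^ 2) / (s ^ 2 - t ^ 2)) / 2) S :=
  ((Real.continuous_arcsin.comp (by fun_prop)).div_const 2).continuousOn

lemma abel_kernel_eq_zero {t s x : ℝ} (hs : 0 ≤ s) (hx : s ≤ x) :
    x / √(s ^ 2 - x ^ 2) / √(x ^ 2 - t ^ 2) = 0 := by
  rw [Real.sqrt_eq_zero_of_nonpos (by nlinarith), div_zero, zero_div]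

lemma abel_kernel_nonneg {t s x : ℝ} (hx : 0 ≤ x) :
    0 ≤ x / √(s ^ 2 - x ^ 2) / √(x ^ 2 - t ^ 2) := by positivity

lemma integrableOn_Ioc_abel_kernel {t s : ℝ} (ht : 0 < t) :
    IntegrableOn (fun x => x / √(s ^ 2 - x ^ 2) / √(x ^ 2 - t ^ 2)) (Ioc t s) :=
  intervalIntegral.integrableOn_deriv_of_nonneg (continuousOn_half_arcsin_kernel t s _)
    (fun _ hx => hasDerivAt_half_arcsin_kernel ht hx)
    fun _ hx => abel_kernel_nonneg (ht.trans hx.1).le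

lemma integrableOn_Ioi_abel_kernel {t s : ℝ} (ht : 0 < t) (hts : t < s) :
    IntegrableOn (fun x => x / √(s ^ 2 - x ^ 2) / √(x ^ 2 - t ^ 2)) (Ioi t) := by
  rw [← Ioc_union_Ioi_eq_Ioi hts.le]
  refine (integrableOn_Ioc_abel_kernel ht).union ?_
  exact integrableOn_zero.congr_fun
    (fun x hx => (abel_kernel_eq_zero (ht.trans hts).le (le_of_lt hx)).symm) measurableSet_Ioi

lemma integral_Ioi_abel_kernel {t s : ℝ} (ht : 0 < t) (hts : t < s) :
    ∫ x in Ioi t, x / √(s ^ 2 - x ^ 2) / √(x ^ 2 - t ^ 2) = Real.pi / 2 := by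
  have h3 : s ^ 2 - t ^ 2 ≠ 0 := by nlinarith
  rw [setIntegral_eq_of_subset_of_forall_sdiff_eq_zero measurableSet_Ioi
    (Ioc_subset_Ioi_self : Ioc t s ⊆ Ioi t), ← intervalIntegral.integral_of_le hts.le,
    intervalIntegral.integral_eq_sub_of_hasDerivAt_of_le hts.le
      (continuousOn_half_arcsin_kernel t s _) (fun x hx => hasDerivAt_half_arcsin_kernel ht hx)
      ((intervalIntegrable_iff_integrableOn_Ioc_of_le hts.le).2 (integrableOn_Ioc_abel_kernel ht))]
  · have e1 : (2 * s ^ 2 - s ^ 2 - t ^ 2) / (s ^ 2 - t ^ 2) = 1 := by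
      rw [div_eq_one_iff_eq h3]; ring
    have e2 : (2 * t ^ 2 - s ^ 2 - t ^ 2) / (s ^ 2 - t ^ 2) = -1 := by
      rw [div_eq_iff h3]; ring
    rw [e1, e2, Real.arcsin_one, Real.arcsin_neg_one]
    ring
  · intro x hx
    have hsx : s < x := by
      by_contra! h
      exact hx.2 ⟨hx.1, h⟩
    exact abel_kernel_eq_zero (ht.trans hts).le hsx.le

/-- `x / (s √(s² - x²))` is integrable over `s > x`, being the derivative of `arccos (x / s)`. -/
lemma integrableOn_Ioi_div_mul_sqrt {x : ℝ} (hx : 0 < x) :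
    IntegrableOn (fun s => x / (s * √(s ^ 2 - x ^ 2))) (Ioi x) := by
  refine integrableOn_Ioi_deriv_of_nonneg (g := fun s => Real.arccos (x / s))
    (l := Real.arccos 0) ?_ ?_ ?_ ?_
  · exact (Real.continuous_arccos.continuousAt.comp
      (continuousAt_const.div continuousAt_id hx.ne')).continuousWithinAt
  · intro s hs
    have hs : x < s := hs
    have hs0 : 0 < s := hx.trans hs
    have h1 : 0 < s ^ 2 - x ^ 2 := by nlinarith
    have hlt : x / s < 1 := (div_lt_one hs0).2 hs
    have hpos : 0 < x / s := div_pos hx hs0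
    have hd : HasDerivAt (fun s => x / s) (-x / s ^ 2) s := by
      convert! (hasDerivAt_inv hs0.ne').const_mul x using 1
      ring
    have hsq : 1 - (x / s) ^ 2 = (√(s ^ 2 - x ^ 2) / s) ^ 2 := by
      rw [div_pow, div_pow, Real.sq_sqrt h1.le]
      field_simp
    have hp := Real.sqrt_pos.2 h1
    convert! (Real.hasDerivAt_arccos (by linarith) hlt.ne).comp s hd using 1
    rw [hsq, Real.sqrt_sq (by positivity)]
    field_simp
  · intro s hs
    have : 0 < s := hx.trans hs
    positivity
  · exact (Real.continuous_arccos.tendsto 0).comp (tendsto_const_nhds.div_atTop tendsto_id)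

/-- The Abel transform with infinite upper endpoint converges absolutely when `s * y s` is
bounded. -/
lemma integrableOn_Ioi_abel {x M : ℝ} (hx : 0 < x) {y : ℝ → ℝ}
    (hy : AEStronglyMeasurable y (volume.restrict (Ioi x)))
    (hM : ∀ s, x < s → |y s * s| ≤ M) :
    IntegrableOn (fun s => y s * x / √(s ^ 2 - x ^ 2)) (Ioi x) := by
  have h : IntegrableOn (fun s => (y s * s) * (x / (s * √(s ^ 2 - x ^ 2)))) (Ioi x) :=
    (integrableOn_Ioi_div_mul_sqrt hx).bdd_mul (c := M) (hy.mul aestronglyMeasurable_id)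
      (ae_restrict_of_forall_mem measurableSet_Ioi hM)
  refine h.congr_fun (fun s hs => ?_) measurableSet_Ioi
  have hs0 : s ≠ 0 := (hx.trans hs).ne'
  beta_reduce
  rw [mul_assoc, mul_div_assoc' s, mul_div_mul_left _ _ hs0, mul_div_assoc]

lemma integrable_prod_abel {t : ℝ} (ht : 0 < t) {y : ℝ → ℝ} (hy : IntegrableOn y (Ioi t)) :
    Integrable
      (Function.uncurry fun x s : ℝ => y s * (x / √(s ^ 2 - x ^ 2) / √(x ^ 2 - t ^ 2)))
      ((volume.restrict (Ioi t)).prod (volume.restrict (Ioi t))) := by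
  have hmeas : AEStronglyMeasurable
      (Function.uncurry fun x s : ℝ => y s * (x / √(s ^ 2 - x ^ 2) / √(x ^ 2 - t ^ 2)))
      ((volume.restrict (Ioi t)).prod (volume.restrict (Ioi t))) := by
    refine (hy.aestronglyMeasurable.comp_snd).mul (Measurable.aestronglyMeasurable ?_)
    fun_prop
  refine (integrable_prod_iff' hmeas).2 ⟨?_, ?_⟩
  · exact ae_restrict_of_forall_mem measurableSet_Ioi fun s hs =>
      (integrableOn_Ioi_abel_kernel ht hs).const_mul (y s)
  · refine (hy.norm.mul_const (Real.pi / 2)).congr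
      (ae_restrict_of_forall_mem measurableSet_Ioi fun s hs => ?_)
    have hs : t < s := hs
    beta_reduce
    rw [← integral_Ioi_abel_kernel ht hs, ← integral_const_mul]
    refine setIntegral_congr_fun measurableSet_Ioi fun x hx => ?_
    simp only [Function.uncurry_apply_pair, norm_mul]
    rw [Real.norm_of_nonneg (abel_kernel_nonneg (ht.trans hx).le)]

lemma integral_Ioi_abel_div {t x : ℝ} (ht : 0 < t) (hx : t < x) (y : ℝ → ℝ) :
    ∫ s in Ioi t, y s * (x / √(s ^ 2 - x ^ 2) / √(x ^ 2 - t ^ 2)) =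
      (∫ s in Ioi x, y s * x / √(s ^ 2 - x ^ 2)) / √(x ^ 2 - t ^ 2) := by
  rw [← integral_div, setIntegral_eq_of_subset_of_forall_sdiff_eq_zero measurableSet_Ioi
    (Ioi_subset_Ioi hx.le)]
  · exact integral_congr_ae (Eventually.of_forall fun s => by ring)
  · intro s hs
    have hts : t < s := hs.1
    rw [abel_kernel_eq_zero (ht.trans hts).le (not_lt.1 hs.2), mul_zero]

lemma integrableOn_Ioi_abel_abel {t : ℝ} (ht : 0 < t) {y : ℝ → ℝ}
    (hy : IntegrableOn y (Ioi t)) :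
    IntegrableOn (fun x => (∫ s in Ioi x, y s * x / √(s ^ 2 - x ^ 2)) / √(x ^ 2 - t ^ 2))
      (Ioi t) :=
  (integrable_prod_abel ht hy).integral_prod_left.congr
    (ae_restrict_of_forall_mem measurableSet_Ioi fun _ hx => integral_Ioi_abel_div ht hx y)

/-- Applying the Abel transform twice gives `π / 2` times the tail integral. -/
lemma integral_Ioi_abel_abel {t : ℝ} (ht : 0 < t) {y : ℝ → ℝ} (hy : IntegrableOn y (Ioi t)) :
    ∫ x in Ioi t, (∫ s in Ioi x, y s * x / √(s ^ 2 - x ^ 2)) / √(x ^ 2 - t ^ 2) =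
      Real.pi / 2 * ∫ s in Ioi t, y s := by
  calc
    _ = ∫ x in Ioi t, ∫ s in Ioi t, y s * (x / √(s ^ 2 - x ^ 2) / √(x ^ 2 - t ^ 2)) :=
      setIntegral_congr_fun measurableSet_Ioi fun x hx => (integral_Ioi_abel_div ht hx y).symm
    _ = ∫ s in Ioi t, ∫ x in Ioi t, y s * (x / √(s ^ 2 - x ^ 2) / √(x ^ 2 - t ^ 2)) :=
      integral_integral_swap (integrable_prod_abel ht hy)
    _ = ∫ s in Ioi t, Real.pi / 2 * y s :=
      setIntegral_congr_fun measurableSet_Ioi fun s hs => by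
        simp only [integral_const_mul]
        rw [integral_Ioi_abel_kernel ht hs, mul_comm]
    _ = _ := integral_const_mul _ _

lemma hasDerivAt_integral_Ioi {b t : ℝ} (hbt : b < t) {y : ℝ → ℝ}
    (hy : ContinuousOn y (Ici b)) (hint : IntegrableOn y (Ioi b)) :
    HasDerivAt (fun u => ∫ s in Ioi u, y s) (-y t) t := by
  have hmem : Ici b ∈ 𝓝 t := Ici_mem_nhds hbt
  have h := (intervalIntegral.integral_hasDerivAt_right
    ((intervalIntegrable_iff_integrableOn_Ioc_of_le hbt.le).2
      (hint.mono_set Ioc_subset_Ioi_self))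
    ⟨Ici b, hmem, hy.aestronglyMeasurable measurableSet_Ici⟩
    (hy.continuousAt hmem)).const_sub (∫ s in Ioi b, y s)
  refine h.congr_of_eventuallyEq ?_
  filter_upwards [Ioi_mem_nhds hbt] with u hu
  rw [← intervalIntegral.integral_Ioi_sub_Ioi hint (le_of_lt hu), sub_sub_cancel]

/-- Abel inversion formula with infinite upper endpoint: for `b > 0`, `δ > 0`, `C > 0`,
`y` continuous on `[b, ∞)` with `|y s| ≤ C·s^(−1−δ)`, and
`F x = ∫_x^∞ y s · x / √(s² − x²) ds` (absolutely convergent), one has for `t > b`: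
(i) `∫_t^∞ F x / √(x² − t²) dx = (π/2) ∫_t^∞ y s ds`, and
(ii) `y t = −(2/π) · d/dt ∫_t^∞ F x / √(x² − t²) dx`. -/
theorem stmt_3 (b δ C : ℝ) (hb : 0 < b) (hδ : 0 < δ) (hC : 0 < C)
    (y : ℝ → ℝ) (hy : ContinuousOn y (Set.Ici b))
    (hbound : ∀ s : ℝ, b ≤ s → |y s| ≤ C * s ^ (-1 - δ : ℝ)) :
    (∀ x : ℝ, b ≤ x →
      IntegrableOn (fun s => y s * x / Real.sqrt (s ^ 2 - x ^ 2)) (Set.Ioi x)) ∧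
    ∀ t : ℝ, b < t →
      (IntegrableOn
          (fun x => (∫ s in Set.Ioi x, y s * x / Real.sqrt (s ^ 2 - x ^ 2)) /
            Real.sqrt (x ^ 2 - t ^ 2)) (Set.Ioi t) ∧
        (∫ x in Set.Ioi t,
            (∫ s in Set.Ioi x, y s * x / Real.sqrt (s ^ 2 - x ^ 2)) /
              Real.sqrt (x ^ 2 - t ^ 2)) =
          Real.pi / 2 * ∫ s in Set.Ioi t, y s) ∧
      DifferentiableAt ℝ
        (fun u => ∫ x in Set.Ioi u,
          (∫ s in Set.Ioi x, y s * x / Real.sqrt (s ^ 2 - x ^ 2)) /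
            Real.sqrt (x ^ 2 - u ^ 2)) t ∧
      y t = -(2 / Real.pi) *
        deriv (fun u => ∫ x in Set.Ioi u,
          (∫ s in Set.Ioi x, y s * x / Real.sqrt (s ^ 2 - x ^ 2)) /
            Real.sqrt (x ^ 2 - u ^ 2)) t := by
  have hint : IntegrableOn y (Ioi b) := by
    refine Integrable.mono'
      ((integrableOn_Ioi_rpow_of_lt (by linarith : -1 - δ < -1) hb).const_mul C)
      ((hy.mono Ioi_subset_Ici_self).aestronglyMeasurable measurableSet_Ioi) ?_
    exact ae_restrict_of_forall_mem measurableSet_Ioi fun s hs => hbound s (le_of_lt hs)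
  have hM : ∀ s, b ≤ s → |y s * s| ≤ C * b ^ (-δ) := by
    intro s hs
    have hs0 : 0 < s := hb.trans_le hs
    calc |y s * s| = |y s| * s := by rw [abs_mul, abs_of_pos hs0]
      _ ≤ C * s ^ (-1 - δ) * s := by gcongr; exact hbound s hs
      _ = C * s ^ (-δ) := by
        rw [mul_assoc, ← Real.rpow_add_one hs0.ne']
        congr 2
        ring
      _ ≤ C * b ^ (-δ) :=
        mul_le_mul_of_nonneg_left (Real.rpow_le_rpow_of_nonpos hb hs (by linarith)) hC.le
  refine ⟨fun x hx => integrableOn_Ioi_abel (hb.trans_le hx)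
    (hint.mono_set (Ioi_subset_Ioi hx)).aestronglyMeasurable
    fun s hs => hM s (hx.trans hs.le), fun t ht => ?_⟩
  have hintt : ∀ u, b < u → IntegrableOn y (Ioi u) := fun u hu =>
    hint.mono_set (Ioi_subset_Ioi hu.le)
  have hd : HasDerivAt (fun u => ∫ x in Ioi u,
      (∫ s in Ioi x, y s * x / √(s ^ 2 - x ^ 2)) / √(x ^ 2 - u ^ 2))
      (Real.pi / 2 * -y t) t := by
    refine ((hasDerivAt_integral_Ioi ht hy hint).const_mul (Real.pi / 2)).congr_of_eventuallyEq ?_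
    filter_upwards [Ioi_mem_nhds ht] with u hu
    exact integral_Ioi_abel_abel (hb.trans hu) (hintt u hu)
  refine ⟨⟨integrableOn_Ioi_abel_abel (hb.trans ht) (hintt t ht),
    integral_Ioi_abel_abel (hb.trans ht) (hintt t ht)⟩, hd.differentiableAt, ?_⟩
  rw [hd.deriv]
  field_simp
end

section
/- Let f₀ > 0, η₀ < η₁, and let V : [η₀, η₁] → ℝ be twice continuously differentiable with V'(η) > 0 for all η ∈ [η₀, η₁] and V(η₀) = f₀². Then the improper integral ∫_{η₀}^{η₁} f₀·V(η)^{−1/4}/√(V(η) − f₀²) dη converges and equals −∫_{η₀}^{η₁} arctan(√(V(η) − f₀²)/f₀) · (d/dη)(2V(η)^{3/4}/V'(η)) dη + arctan(√(V(η₁) − f₀²)/f₀) · 2V(η₁)^{3/4}/V'(η₁). -/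
open MeasureTheory

/-- The antiderivative relation behind the integration by parts. -/
lemma hasDerivAt_arctan_sqrt_sub_sq_div {c x v' : ℝ} {v : ℝ → ℝ} (hc : 0 < c)
    (hv : HasDerivAt v v' x) (hx : c ^ 2 < v x) :
    HasDerivAt (fun y => Real.arctan (Real.sqrt (v y - c ^ 2) / c))
      (v' * c / (2 * v x * Real.sqrt (v x - c ^ 2))) x := by
  have hpos : 0 < v x - c ^ 2 := sub_pos.2 hx
  have hs : 0 < Real.sqrt (v x - c ^ 2) := Real.sqrt_pos.2 hpos
  have hv0 : 0 < v x := (by positivity : (0 : ℝ) < c ^ 2).trans hx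
  have hsq : Real.sqrt (v x - c ^ 2) ^ 2 = v x - c ^ 2 := Real.sq_sqrt hpos.le
  convert (((hv.sub_const (c ^ 2)).sqrt hpos.ne').div_const c).arctan using 1
  have h : 1 + (Real.sqrt (v x - c ^ 2) / c) ^ 2 = v x / c ^ 2 := by
    rw [div_pow, hsq]
    field_simp
    ring
  rw [h]
  field_simp

/-- The derivative of `2 * v ^ (3 / 4) / w`, in quotient-rule form. -/
lemma hasDerivAt_two_mul_rpow_div {x v' w' : ℝ} {v w : ℝ → ℝ} (hv : HasDerivAt v v' x)
    (hw : HasDerivAt w w' x) (hvx : 0 < v x) (hwx : w x ≠ 0) :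
    HasDerivAt (fun u => 2 * v u ^ ((3 : ℝ) / 4) / w u)
      ((2 * (v' * (3 / 4) * v x ^ ((3 : ℝ) / 4 - 1)) * w x -
        2 * v x ^ ((3 : ℝ) / 4) * w') / w x ^ 2) x :=
  ((hv.rpow_const (Or.inl hvx.ne')).const_mul 2).div hw hwx

/-- Integration-by-parts identity for the holographic interquark distance integral:
with `V` twice continuously differentiable on `[η₀, η₁]`, `V' > 0`, `V η₀ = f₀²`,
the improper integral `∫_{η₀}^{η₁} f₀·V^{−1/4}/√(V − f₀²) dη` converges and equals
`−∫_{η₀}^{η₁} arctan(√(V − f₀²)/f₀)·(d/dη)(2V^{3/4}/V') dη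
  + arctan(√(V(η₁) − f₀²)/f₀)·2V(η₁)^{3/4}/V'(η₁)`. -/
theorem stmt_5 (f₀ η₀ η₁ : ℝ) (hf₀ : 0 < f₀) (hη : η₀ < η₁)
    (V V' V'' : ℝ → ℝ)
    (hV : ∀ η ∈ Set.Icc η₀ η₁, HasDerivAt V (V' η) η)
    (hV' : ∀ η ∈ Set.Icc η₀ η₁, HasDerivAt V' (V'' η) η)
    (hV'' : ContinuousOn V'' (Set.Icc η₀ η₁))
    (hpos : ∀ η ∈ Set.Icc η₀ η₁, 0 < V' η)
    (hV0 : V η₀ = f₀ ^ 2) :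
    IntegrableOn (fun η => f₀ * V η ^ (-(1 : ℝ) / 4) / Real.sqrt (V η - f₀ ^ 2))
      (Set.Ioo η₀ η₁) ∧
    ∫ η in Set.Ioo η₀ η₁, f₀ * V η ^ (-(1 : ℝ) / 4) / Real.sqrt (V η - f₀ ^ 2) =
      -(∫ η in η₀..η₁,
          Real.arctan (Real.sqrt (V η - f₀ ^ 2) / f₀) *
            deriv (fun u => 2 * V u ^ ((3 : ℝ) / 4) / V' u) η) +
        Real.arctan (Real.sqrt (V η₁ - f₀ ^ 2) / f₀) * (2 * V η₁ ^ ((3 : ℝ) / 4) / V' η₁) := by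
  have hVc : ContinuousOn V (Set.Icc η₀ η₁) := fun x hx => (hV x hx).continuousAt.continuousWithinAt
  have hV'c : ContinuousOn V' (Set.Icc η₀ η₁) :=
    fun x hx => (hV' x hx).continuousAt.continuousWithinAt
  have hmono : StrictMonoOn V (Set.Icc η₀ η₁) := by
    refine strictMonoOn_of_deriv_pos (convex_Icc _ _) hVc fun x hx => ?_
    have hx' := interior_subset hx
    rw [(hV x hx').deriv]
    exact hpos x hx'
  have hleft : η₀ ∈ Set.Icc η₀ η₁ := Set.left_mem_Icc.2 hη.le
  have hlt : ∀ x ∈ Set.Ioo η₀ η₁, f₀ ^ 2 < V x := fun x hx =>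
    hV0 ▸ hmono hleft (Set.Ioo_subset_Icc_self hx) hx.1
  have hVpos : ∀ x ∈ Set.Icc η₀ η₁, 0 < V x := fun x hx =>
    (by rw [hV0]; positivity : 0 < V η₀).trans_le (hmono.monotoneOn hleft hx hx.1)
  set A : ℝ → ℝ := fun η => Real.arctan (Real.sqrt (V η - f₀ ^ 2) / f₀) with hA
  set B : ℝ → ℝ := fun u => 2 * V u ^ ((3 : ℝ) / 4) / V' u with hB
  let A' : ℝ → ℝ := fun η => V' η * f₀ / (2 * V η * Real.sqrt (V η - f₀ ^ 2))
  let B' : ℝ → ℝ := fun η => (2 * (V' η * (3 / 4) * V η ^ ((3 : ℝ) / 4 - 1)) * V' η -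
        2 * V η ^ ((3 : ℝ) / 4) * V'' η) / V' η ^ 2
  have hAd : ∀ x ∈ Set.Ioo η₀ η₁, HasDerivAt A (A' x) x := fun x hx =>
    hasDerivAt_arctan_sqrt_sub_sq_div hf₀ (hV x (Set.Ioo_subset_Icc_self hx)) (hlt x hx)
  have hBd : ∀ x ∈ Set.Icc η₀ η₁, HasDerivAt B (B' x) x := fun x hx =>
    hasDerivAt_two_mul_rpow_div (hV x hx) (hV' x hx) (hVpos x hx) (hpos x hx).ne'
  have hAc : ContinuousOn A (Set.Icc η₀ η₁) :=
    Real.continuous_arctan.comp_continuousOn ((hVc.sub continuousOn_const).sqrt.div_const f₀)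
  have hBc : ContinuousOn B (Set.Icc η₀ η₁) :=
    fun x hx => (hBd x hx).continuousAt.continuousWithinAt
  have hrpow : ∀ p : ℝ, ContinuousOn (fun x => V x ^ p) (Set.Icc η₀ η₁) := fun p =>
    hVc.rpow_const fun x hx => Or.inl (hVpos x hx).ne'
  have hB'c : ContinuousOn B' (Set.Icc η₀ η₁) := by
    refine ContinuousOn.div (((continuousOn_const.mul
      ((hV'c.mul continuousOn_const).mul (hrpow _))).mul hV'c).sub
      ((continuousOn_const.mul (hrpow _)).mul hV'')) (hV'c.pow 2) fun x hx => ?_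
    exact pow_ne_zero 2 (hpos x hx).ne'
  have hA'i : IntervalIntegrable A' volume η₀ η₁ := by
    rw [intervalIntegrable_iff_integrableOn_Ioc_of_le hη.le]
    refine intervalIntegral.integrableOn_deriv_of_nonneg hAc hAd fun x hx => ?_
    have h₁ := hpos x (Set.Ioo_subset_Icc_self hx)
    have h₂ := hVpos x (Set.Ioo_subset_Icc_self hx)
    positivity
  have hB'i : IntervalIntegrable B' volume η₀ η₁ := hB'c.intervalIntegrable_of_Icc hη.le
  have hA'Bi : IntervalIntegrable (fun x => A' x * B x) volume η₀ η₁ :=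
    hA'i.mul_continuousOn (by rwa [Set.uIcc_of_le hη.le])
  have heq : Set.EqOn (fun x => A' x * B x)
      (fun η => f₀ * V η ^ (-(1 : ℝ) / 4) / Real.sqrt (V η - f₀ ^ 2)) (Set.Ioo η₀ η₁) := by
    intro x hx
    have h₁ := hpos x (Set.Ioo_subset_Icc_self hx)
    have h₂ := hVpos x (Set.Ioo_subset_Icc_self hx)
    have h₃ : 0 < Real.sqrt (V x - f₀ ^ 2) := Real.sqrt_pos.2 (sub_pos.2 (hlt x hx))
    have h₄ : V x ^ ((3 : ℝ) / 4) = V x * V x ^ (-(1 : ℝ) / 4) := by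
      rw [← Real.rpow_one_add' h₂.le (by norm_num)]
      norm_num
    simp only [A', B, h₄]
    field_simp
  have hA0 : A η₀ = 0 := by simp [hA, hV0]
  have hparts := intervalIntegral.integral_mul_deriv_eq_deriv_mul_of_hasDerivAt
    (u := A) (v := B) (u' := A') (v' := B')
    (by rwa [Set.uIcc_of_le hη.le]) (by rwa [Set.uIcc_of_le hη.le])
    (by rwa [min_eq_left hη.le, max_eq_right hη.le])
    (fun x hx => hBd x (Set.Ioo_subset_Icc_self
      (by rwa [min_eq_left hη.le, max_eq_right hη.le] at hx))) hA'i hB'i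
  have hderiv : ∫ x in η₀..η₁, A x * deriv B x = ∫ x in η₀..η₁, A x * B' x := by
    refine intervalIntegral.integral_congr fun x hx => ?_
    rw [Set.uIcc_of_le hη.le] at hx
    simp only [(hBd x hx).deriv]
  constructor
  · refine IntegrableOn.congr_fun ?_ heq measurableSet_Ioo
    exact ((intervalIntegrable_iff_integrableOn_Ioc_of_le hη.le).1 hA'Bi).mono_set
      Set.Ioo_subset_Ioc_self
  · rw [← setIntegral_congr_fun measurableSet_Ioo heq, ← integral_Ioc_eq_integral_Ioo,
      ← intervalIntegral.integral_of_le hη.le]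
    change _ = -(∫ x in η₀..η₁, A x * deriv B x) + A η₁ * B η₁
    rw [hderiv, hparts, hA0]
    ring
end

section
/- Let a < η₁ and let V : [a, η₁] → ℝ be twice continuously differentiable with V'(η) > 0 and V(η) > 0 for all η. For f₀ ∈ (√(V(a)), √(V(η₁))), let η₀(f₀) denote the unique point in (a, η₁) with V(η₀(f₀)) = f₀², and define Ẽ(f₀) := ∫_{η₀(f₀)}^{η₁} V(η)^{3/4}/√(V(η) − f₀²) dη and R̃(f₀) := ∫_{η₀(f₀)}^{η₁} f₀·V(η)^{−1/4}/√(V(η) − f₀²) dη (both improper integrals converge). Then Ẽ and R̃ are differentiable on (√(V(a)), √(V(η₁))) and Ẽ'(f₀) = f₀ · R̃'(f₀) for every such f₀. -/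
open MeasureTheory
open Set Filter Topology

lemma integrableOn_inv_sqrt_Ioo : IntegrableOn (fun τ : ℝ => (√τ)⁻¹) (Ioo 0 1) := by
  refine ((intervalIntegral.integrableOn_Ioo_rpow_iff (s := -(1 / 2)) one_pos).2
    (by norm_num)).congr_fun (fun τ hτ => ?_) measurableSet_Ioo
  simp only [Real.rpow_neg hτ.1.le, Real.sqrt_eq_rpow]

/-- The affine path from `x` to `B` stays in `(A, B)`. -/
lemma segment_mem_Ioo {A B x τ : ℝ} (hx : x ∈ Ioo A B) (hτ : τ ∈ Ioo (0 : ℝ) 1) :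
    x + τ * (B - x) ∈ Ioo A B := by
  obtain ⟨h1, h2⟩ := hx
  obtain ⟨h3, h4⟩ := hτ
  constructor <;> nlinarith [mul_pos h3 (sub_pos.2 h2), mul_pos (sub_pos.2 h4) (sub_pos.2 h2)]

/-- Bounded measurable functions along the path are integrable against `1 / √τ`. -/
lemma integrableOn_segment_mul_inv_sqrt {A B C x : ℝ} {F : ℝ → ℝ} (hx : x ∈ Ioo A B)
    (hm : AEStronglyMeasurable (fun τ => F (x + τ * (B - x))) (volume.restrict (Ioo 0 1)))
    (hF : ∀ w ∈ Ioo A B, |F w| ≤ C) :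
    IntegrableOn (fun τ => F (x + τ * (B - x)) * (√τ)⁻¹) (Ioo 0 1) :=
  Integrable.bdd_mul integrableOn_inv_sqrt_Ioo hm
    ((ae_restrict_iff' measurableSet_Ioo).2
      (Eventually.of_forall fun _ hτ => hF _ (segment_mem_Ioo hx hτ)))

lemma aestronglyMeasurable_segment {A B x : ℝ} {G : ℝ → ℝ} (hx : x ∈ Ioo A B)
    (hG : ∀ w ∈ Ioo A B, DifferentiableAt ℝ G w) :
    AEStronglyMeasurable (fun τ => G (x + τ * (B - x))) (volume.restrict (Ioo 0 1)) := by
  refine ContinuousOn.aestronglyMeasurable (fun τ hτ => ?_) measurableSet_Ioo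
  exact (ContinuousAt.comp (f := fun τ : ℝ => x + τ * (B - x))
    (hG _ (segment_mem_Ioo hx hτ)).continuousAt (by fun_prop)).continuousWithinAt

lemma integrableOn_id_mul_Ioo {F : ℝ → ℝ} (hF : IntegrableOn F (Ioo 0 1)) :
    IntegrableOn (fun τ => τ * F τ) (Ioo 0 1) :=
  Integrable.bdd_mul (c := 1) hF (Measurable.aestronglyMeasurable (by fun_prop))
    ((ae_restrict_iff' measurableSet_Ioo).2 (Eventually.of_forall fun τ hτ => by
      rw [Real.norm_eq_abs, abs_of_pos hτ.1]; exact hτ.2.le))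

lemma integrableOn_one_sub_mul_Ioo {F : ℝ → ℝ} (hF : IntegrableOn F (Ioo 0 1)) :
    IntegrableOn (fun τ => (1 - τ) * F τ) (Ioo 0 1) :=
  (hF.sub (integrableOn_id_mul_Ioo hF)).congr_fun
    (fun τ _ => by simp only [Pi.sub_apply]; ring) measurableSet_Ioo

/-- Differentiation under the integral sign along the path. -/
lemma hasDerivAt_integral_segment {A B C s : ℝ} {G : ℝ → ℝ} (hs : s ∈ Ioo A B)
    (hd : ∀ w ∈ Ioo A B, DifferentiableAt ℝ G w)
    (hG : ∀ w ∈ Ioo A B, |G w| ≤ C) (hG' : ∀ w ∈ Ioo A B, |deriv G w| ≤ C) :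
    HasDerivAt (fun x => ∫ τ in Ioo (0 : ℝ) 1, G (x + τ * (B - x)) * (√τ)⁻¹)
      (∫ τ in Ioo (0 : ℝ) 1, (1 - τ) * (deriv G (s + τ * (B - s)) * (√τ)⁻¹)) s := by
  have hnhds : Ioo A B ∈ 𝓝 s := Ioo_mem_nhds hs.1 hs.2
  have hmeas : Measurable fun τ : ℝ => deriv G (s + τ * (B - s)) :=
    (measurable_deriv G).comp (by fun_prop)
  refine (hasDerivAt_integral_of_dominated_loc_of_deriv_le
    (F := fun x τ => G (x + τ * (B - x)) * (√τ)⁻¹)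
    (F' := fun x τ => (1 - τ) * (deriv G (x + τ * (B - x)) * (√τ)⁻¹))
    (bound := fun τ => C * (√τ)⁻¹) hnhds ?_ ?_ ?_ ?_ ?_ ?_).2
  · filter_upwards [hnhds] with x hx
    exact (integrableOn_segment_mul_inv_sqrt hx (aestronglyMeasurable_segment hx hd)
      hG).aestronglyMeasurable
  · exact integrableOn_segment_mul_inv_sqrt hs (aestronglyMeasurable_segment hs hd) hG
  · exact Measurable.aestronglyMeasurable (by fun_prop)
  · refine (ae_restrict_iff' measurableSet_Ioo).2 (Eventually.of_forall fun τ hτ x hx => ?_)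
    have h1 := hG' _ (segment_mem_Ioo hx hτ)
    have h2 : 0 ≤ (√τ)⁻¹ := by positivity
    have h3 : |1 - τ| ≤ 1 := by
      rw [abs_le]
      constructor <;> linarith [hτ.1, hτ.2]
    rw [Real.norm_eq_abs, abs_mul, abs_mul, abs_of_nonneg h2]
    calc |1 - τ| * (|deriv G (x + τ * (B - x))| * (√τ)⁻¹)
        ≤ 1 * (C * (√τ)⁻¹) := by gcongr
      _ = C * (√τ)⁻¹ := one_mul _
  · exact Integrable.const_mul integrableOn_inv_sqrt_Ioo C
  · refine (ae_restrict_iff' measurableSet_Ioo).2 (Eventually.of_forall fun τ hτ x hx => ?_)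
    have h1 : HasDerivAt (fun x : ℝ => x + τ * (B - x)) (1 - τ) x := by
      have := (hasDerivAt_id x).add (((hasDerivAt_id x).const_sub B).const_mul τ)
      exact this.congr_deriv (by ring)
    exact (((hd _ (segment_mem_Ioo hx hτ)).hasDerivAt.comp x h1).mul_const _).congr_deriv
      (by ring)

/-- Integration by parts against `(1 - τ) √τ`, which vanishes at both ends. -/
lemma integral_deriv_segment {A B C s : ℝ} {G : ℝ → ℝ} (hs : s ∈ Ioo A B)
    (hd : ∀ w ∈ Ioo A B, DifferentiableAt ℝ G w)
    (hG : ∀ w ∈ Ioo A B, |G w| ≤ C) (hG' : ∀ w ∈ Ioo A B, |deriv G w| ≤ C) :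
    (B - s) * ∫ τ in Ioo (0 : ℝ) 1, τ * ((1 - τ) * (deriv G (s + τ * (B - s)) * (√τ)⁻¹)) =
      3 / 2 * (∫ τ in Ioo (0 : ℝ) 1, τ * (G (s + τ * (B - s)) * (√τ)⁻¹)) -
      1 / 2 * ∫ τ in Ioo (0 : ℝ) 1, G (s + τ * (B - s)) * (√τ)⁻¹ := by
  have hmeas : Measurable fun τ : ℝ => deriv G (s + τ * (B - s)) :=
    (measurable_deriv G).comp (by fun_prop)
  have i0 := integrableOn_segment_mul_inv_sqrt hs (aestronglyMeasurable_segment hs hd) hG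
  have i1 := integrableOn_id_mul_Ioo i0
  have j0 := integrableOn_one_sub_mul_Ioo
    (integrableOn_segment_mul_inv_sqrt hs hmeas.aestronglyMeasurable hG')
  have j1 := integrableOn_id_mul_Ioo j0
  have hint := ((j1.const_mul (B - s)).sub (i1.const_mul (3 / 2))).add (i0.const_mul (1 / 2))
  have hzero : ∀ l : Filter ℝ, Tendsto (fun τ : ℝ => C * ((1 - τ) * √τ)) l (𝓝 0) →
      (∀ᶠ τ in l, τ ∈ Ioo (0 : ℝ) 1) →
      Tendsto (fun τ => G (s + τ * (B - s)) * ((1 - τ) * √τ)) l (𝓝 0) := by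
    intro l hl hmem
    refine squeeze_zero_norm' ?_ hl
    filter_upwards [hmem] with τ hτ
    have h2 : 0 ≤ (1 - τ) * √τ := mul_nonneg (by linarith [hτ.2]) (Real.sqrt_nonneg _)
    rw [Real.norm_eq_abs, abs_mul, abs_of_nonneg h2]
    exact mul_le_mul_of_nonneg_right (hG _ (segment_mem_Ioo hs hτ)) h2
  have hcont : Continuous fun τ : ℝ => C * ((1 - τ) * √τ) := by fun_prop
  have key := intervalIntegral.integral_eq_sub_of_hasDerivAt_of_tendsto (a := 0) (b := 1)
    one_pos (f := fun τ => G (s + τ * (B - s)) * ((1 - τ) * √τ)) (fa := 0) (fb := 0)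
    (fun τ hτ => ?_)
    ((intervalIntegrable_iff_integrableOn_Ioo_of_le zero_le_one).2 hint)
    (hzero _ ((hcont.tendsto' 0 0 (by simp)).mono_left nhdsWithin_le_nhds)
      (Ioo_mem_nhdsGT one_pos))
    (hzero _ ((hcont.tendsto' 1 0 (by simp)).mono_left nhdsWithin_le_nhds)
      (Ioo_mem_nhdsLT one_pos))
  · rw [intervalIntegral.integral_of_le zero_le_one, integral_Ioc_eq_integral_Ioo] at key
    rw [integral_add' ((j1.const_mul (B - s)).sub (i1.const_mul (3 / 2))) (i0.const_mul (1 / 2)),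
      integral_sub' (j1.const_mul (B - s)) (i1.const_mul (3 / 2))] at key
    simp only [integral_const_mul] at key
    linarith
  · have h1 : HasDerivAt (fun τ : ℝ => s + τ * (B - s)) (B - s) τ := by
      simpa using ((hasDerivAt_id τ).mul_const (B - s)).const_add s
    have h2 : HasDerivAt (fun τ : ℝ => (1 - τ) * √τ) (-1 * √τ + (1 - τ) * (1 / (2 * √τ))) τ :=
      ((hasDerivAt_id τ).const_sub 1).mul (Real.hasDerivAt_sqrt hτ.1.ne')
    refine (((hd _ (segment_mem_Ioo hs hτ)).hasDerivAt.comp τ h1).mul h2).congr_deriv ?_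
    have h3 : 0 < √τ := Real.sqrt_pos.2 hτ.1
    obtain ⟨r, hr⟩ : ∃ r, r = √τ := ⟨_, rfl⟩
    have h4 : τ = r ^ 2 := by rw [hr, Real.sq_sqrt hτ.1.le]
    simp only [Pi.add_apply, Pi.sub_apply, Function.comp]
    rw [← hr] at h3 ⊢
    generalize G (s + τ * (B - s)) = g
    generalize deriv G (s + τ * (B - s)) = g'
    subst h4
    field_simp
    ring

/-- The Abel-type transform of `G`, normalised to a fixed domain of integration: for `s < B` it
equals `∫_s^B G(w) / √(w - s) dw`. -/
noncomputable def abelTransform (B : ℝ) (G : ℝ → ℝ) (s : ℝ) : ℝ :=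
  √(B - s) * ∫ τ in Ioo (0 : ℝ) 1, G (s + τ * (B - s)) * (√τ)⁻¹

/-- The transforms of `G` and of `w ↦ w * G w` are differentiable, and their derivatives are
related. -/
lemma exists_hasDerivAt_abelTransform {A B C s : ℝ} {G : ℝ → ℝ} (hs : s ∈ Ioo A B)
    (hd : ∀ w ∈ Ioo A B, DifferentiableAt ℝ G w)
    (hG : ∀ w ∈ Ioo A B, |G w| ≤ C) (hG' : ∀ w ∈ Ioo A B, |deriv G w| ≤ C) :
    ∃ d, HasDerivAt (abelTransform B G) d s ∧
      HasDerivAt (abelTransform B fun w => w * G w) (abelTransform B G s / 2 + s * d) s := by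
  have hC : 0 ≤ C := (abs_nonneg _).trans (hG s hs)
  have hderiv : ∀ w ∈ Ioo A B, HasDerivAt (fun w => w * G w) (G w + w * deriv G w) w :=
    fun w hw => ((hasDerivAt_id w).mul (hd w hw).hasDerivAt).congr_deriv (by simp)
  have hw : ∀ w ∈ Ioo A B, |w| ≤ |A| + |B| := fun w hw => by
    rw [abs_le]
    constructor <;>
      linarith [hw.1, hw.2, neg_abs_le A, neg_abs_le B, le_abs_self A, le_abs_self B,
        abs_nonneg A, abs_nonneg B]
  have hmul : ∀ w ∈ Ioo A B, ∀ y, |y| ≤ C → |w * y| ≤ (|A| + |B|) * C := fun w hw' y hy => by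
    rw [abs_mul]; exact mul_le_mul (hw w hw') hy (abs_nonneg _) (by positivity)
  have HG := hasDerivAt_integral_segment hs hd hG hG'
  have HH := hasDerivAt_integral_segment (G := fun w => w * G w) (C := C + (|A| + |B|) * C) hs
    (fun w hw => (hderiv w hw).differentiableAt)
    (fun w hw => (hmul w hw _ (hG w hw)).trans (by linarith))
    (fun w hw => by
      rw [(hderiv w hw).deriv]
      exact (abs_add_le _ _).trans (add_le_add (hG w hw) (hmul w hw _ (hG' w hw))))
  have parts := integral_deriv_segment hs hd hG hG'
  have hmeas : Measurable fun τ : ℝ => deriv G (s + τ * (B - s)) :=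
    (measurable_deriv G).comp (by fun_prop)
  have i0 := integrableOn_segment_mul_inv_sqrt hs (aestronglyMeasurable_segment hs hd) hG
  have i1 := integrableOn_id_mul_Ioo i0
  have j0 := integrableOn_one_sub_mul_Ioo
    (integrableOn_segment_mul_inv_sqrt hs hmeas.aestronglyMeasurable hG')
  have j1 := integrableOn_id_mul_Ioo j0
  have e1 : ∫ τ in Ioo (0 : ℝ) 1, (s + τ * (B - s)) * G (s + τ * (B - s)) * (√τ)⁻¹ =
      s * (∫ τ in Ioo (0 : ℝ) 1, G (s + τ * (B - s)) * (√τ)⁻¹) +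
      (B - s) * ∫ τ in Ioo (0 : ℝ) 1, τ * (G (s + τ * (B - s)) * (√τ)⁻¹) := by
    rw [← integral_const_mul, ← integral_const_mul,
      ← integral_add (i0.const_mul _) (i1.const_mul _)]
    exact integral_congr_ae (Eventually.of_forall fun τ => by simp only; ring)
  have e2 : ∫ τ in Ioo (0 : ℝ) 1,
        (1 - τ) * (deriv (fun w => w * G w) (s + τ * (B - s)) * (√τ)⁻¹) =
      (∫ τ in Ioo (0 : ℝ) 1, G (s + τ * (B - s)) * (√τ)⁻¹) -
      (∫ τ in Ioo (0 : ℝ) 1, τ * (G (s + τ * (B - s)) * (√τ)⁻¹)) +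
      s * (∫ τ in Ioo (0 : ℝ) 1, (1 - τ) * (deriv G (s + τ * (B - s)) * (√τ)⁻¹)) +
      (B - s) *
        ∫ τ in Ioo (0 : ℝ) 1, τ * ((1 - τ) * (deriv G (s + τ * (B - s)) * (√τ)⁻¹)) := by
    rw [← integral_const_mul, ← integral_const_mul, ← integral_sub' i0 i1,
      ← integral_add' (i0.sub i1) (j0.const_mul _),
      ← integral_add' ((i0.sub i1).add (j0.const_mul _)) (j1.const_mul _)]
    refine setIntegral_congr_fun measurableSet_Ioo fun τ hτ => ?_
    simp only [(hderiv _ (segment_mem_Ioo hs hτ)).deriv, Pi.add_apply, Pi.sub_apply]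
    ring
  have hD : 0 < B - s := sub_pos.2 hs.2
  have hsq : HasDerivAt (fun x => √(B - x)) (-1 / (2 * √(B - s))) s :=
    ((hasDerivAt_id s).const_sub B).sqrt hD.ne'
  refine ⟨_, hsq.mul HG, (hsq.mul HH).congr_deriv ?_⟩
  rw [e1, e2, parts]
  simp only [abelTransform]
  have hr : 0 < √(B - s) := Real.sqrt_pos.2 hD
  have hr2 : B - s = √(B - s) ^ 2 := (Real.sq_sqrt hD.le).symm
  generalize (∫ τ in Ioo (0 : ℝ) 1, G (s + τ * (B - s)) * (√τ)⁻¹) = I0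
  generalize (∫ τ in Ioo (0 : ℝ) 1, τ * (G (s + τ * (B - s)) * (√τ)⁻¹)) = I1
  generalize (∫ τ in Ioo (0 : ℝ) 1, (1 - τ) * (deriv G (s + τ * (B - s)) * (√τ)⁻¹)) = J0
  generalize √(B - s) = r at hr hr2 ⊢
  rw [hr2]
  field_simp
  ring

section Inverse

variable {a b : ℝ} {V V' W : ℝ → ℝ}

lemma strictMonoOn_Icc_of_hasDerivAt_pos (hV : ∀ η ∈ Icc a b, HasDerivAt V (V' η) η)
    (hder : ∀ η ∈ Icc a b, 0 < V' η) : StrictMonoOn V (Icc a b) :=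
  strictMonoOn_of_deriv_pos (convex_Icc a b)
    (fun η hη => (hV η hη).continuousAt.continuousWithinAt)
    fun η hη => by
      rw [(hV η (interior_subset hη)).deriv]
      exact hder η (interior_subset hη)

lemma mem_Ioo_of_strictMonoOn (hmono : StrictMonoOn V (Icc a b)) {η : ℝ} (hη : η ∈ Ioo a b) :
    V η ∈ Ioo (V a) (V b) :=
  ⟨hmono (left_mem_Icc.2 (hη.1.trans hη.2).le) (Ioo_subset_Icc_self hη) hη.1,
    hmono (Ioo_subset_Icc_self hη) (right_mem_Icc.2 (hη.1.trans hη.2).le) hη.2⟩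

lemma inverse_apply (hmono : StrictMonoOn V (Icc a b))
    (hW : ∀ w ∈ Ioo (V a) (V b), W w ∈ Ioo a b ∧ V (W w) = w) {η : ℝ} (hη : η ∈ Ioo a b) :
    W (V η) = η :=
  have h := hW _ (mem_Ioo_of_strictMonoOn hmono hη)
  hmono.injOn (Ioo_subset_Icc_self h.1) (Ioo_subset_Icc_self hη) h.2

lemma strictMonoOn_inverse (hmono : StrictMonoOn V (Icc a b))
    (hW : ∀ w ∈ Ioo (V a) (V b), W w ∈ Ioo a b ∧ V (W w) = w) :
    StrictMonoOn W (Ioo (V a) (V b)) := fun x hx y hy hxy => by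
  rw [← (hW x hx).2, ← (hW y hy).2] at hxy
  exact (hmono.lt_iff_lt (Ioo_subset_Icc_self (hW x hx).1)
    (Ioo_subset_Icc_self (hW y hy).1)).1 hxy

lemma hasDerivAt_inverse (hV : ∀ η ∈ Icc a b, HasDerivAt V (V' η) η)
    (hder : ∀ η ∈ Icc a b, 0 < V' η)
    (hW : ∀ w ∈ Ioo (V a) (V b), W w ∈ Ioo a b ∧ V (W w) = w) {w : ℝ}
    (hw : w ∈ Ioo (V a) (V b)) : HasDerivAt W (V' (W w))⁻¹ w := by
  have hmono := strictMonoOn_Icc_of_hasDerivAt_pos hV hder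
  have hnhds : Ioo (V a) (V b) ∈ 𝓝 w := Ioo_mem_nhds hw.1 hw.2
  have hmem := Ioo_subset_Icc_self (hW w hw).1
  have hcont : ContinuousAt W w := by
    refine (strictMonoOn_inverse hmono hW).continuousAt_of_image_mem_nhds hnhds ?_
    filter_upwards [Ioo_mem_nhds (hW w hw).1.1 (hW w hw).1.2] with η hη
    exact ⟨V η, mem_Ioo_of_strictMonoOn hmono hη, inverse_apply hmono hW hη⟩
  refine (hV _ hmem).of_local_left_inverse hcont (hder _ hmem).ne' ?_
  filter_upwards [hnhds] with y hy using (hW y hy).2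

lemma image_inverse_segment (hmono : StrictMonoOn V (Icc a b))
    (hW : ∀ w ∈ Ioo (V a) (V b), W w ∈ Ioo a b ∧ V (W w) = w) {s : ℝ}
    (hs : s ∈ Ioo (V a) (V b)) :
    (fun τ => W (s + τ * (V b - s))) '' Ioo 0 1 = Ioo (W s) b := by
  have hD : 0 < V b - s := sub_pos.2 hs.2
  ext η
  constructor
  · rintro ⟨τ, hτ, rfl⟩
    have h := segment_mem_Ioo hs hτ
    exact ⟨strictMonoOn_inverse hmono hW hs h (by nlinarith [mul_pos hτ.1 hD]),
      (hW _ h).1.2⟩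
  · intro hη
    have hmem : η ∈ Ioo a b := ⟨(hW s hs).1.1.trans hη.1, hη.2⟩
    have h1 : s < V η := by
      conv_lhs => rw [← (hW s hs).2]
      exact hmono (Ioo_subset_Icc_self (hW s hs).1) (Ioo_subset_Icc_self hmem) hη.1
    have h2 := (mem_Ioo_of_strictMonoOn hmono hmem).2
    refine ⟨(V η - s) / (V b - s), ⟨div_pos (by linarith) hD, (div_lt_one hD).2 (by linarith)⟩, ?_⟩
    simp only [div_mul_cancel₀ _ hD.ne', add_sub_cancel]
    exact inverse_apply hmono hW hmem

/-- Change of variables `V η = s + τ (V b - s)`. -/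
lemma integral_div_sqrt_eq_abelTransform (hV : ∀ η ∈ Icc a b, HasDerivAt V (V' η) η)
    (hder : ∀ η ∈ Icc a b, 0 < V' η)
    (hW : ∀ w ∈ Ioo (V a) (V b), W w ∈ Ioo a b ∧ V (W w) = w) {g G : ℝ → ℝ} {C s : ℝ}
    (hgG : ∀ w ∈ Ioo (V a) (V b), G w = g (W w) / V' (W w))
    (hd : ∀ w ∈ Ioo (V a) (V b), DifferentiableAt ℝ G w)
    (hG : ∀ w ∈ Ioo (V a) (V b), |G w| ≤ C) (hs : s ∈ Ioo (V a) (V b)) :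
    IntegrableOn (fun η => g η / √(V η - s)) (Ioo (W s) b) ∧
      ∫ η in Ioo (W s) b, g η / √(V η - s) = abelTransform (V b) G s := by
  have hmono := strictMonoOn_Icc_of_hasDerivAt_pos hV hder
  have hD : 0 < V b - s := sub_pos.2 hs.2
  have hderiv : ∀ τ ∈ Ioo (0 : ℝ) 1, HasDerivWithinAt (fun τ => W (s + τ * (V b - s)))
      ((V' (W (s + τ * (V b - s))))⁻¹ * (V b - s)) (Ioo 0 1) τ := fun τ hτ => by
    have h1 : HasDerivAt (fun τ : ℝ => s + τ * (V b - s)) (V b - s) τ := by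
      simpa using ((hasDerivAt_id τ).mul_const (V b - s)).const_add s
    exact ((hasDerivAt_inverse hV hder hW (segment_mem_Ioo hs hτ)).comp τ h1).hasDerivWithinAt
  have hinj : InjOn (fun τ => W (s + τ * (V b - s))) (Ioo 0 1) := fun x hx y hy hxy => by
    have h := (strictMonoOn_inverse hmono hW).injOn (segment_mem_Ioo hs hx)
      (segment_mem_Ioo hs hy) hxy
    exact mul_right_cancel₀ hD.ne' (add_left_cancel h)
  have heq : EqOn (fun τ => |(V' (W (s + τ * (V b - s))))⁻¹ * (V b - s)| •
        (g (W (s + τ * (V b - s))) / √(V (W (s + τ * (V b - s))) - s)))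
      (fun τ => √(V b - s) * (G (s + τ * (V b - s)) * (√τ)⁻¹)) (Ioo 0 1) := fun τ hτ => by
    have hw := segment_mem_Ioo hs hτ
    have hp := hder _ (Ioo_subset_Icc_self (hW _ hw).1)
    have hr : 0 < √(V b - s) := Real.sqrt_pos.2 hD
    have hr2 : V b - s = √(V b - s) ^ 2 := (Real.sq_sqrt hD.le).symm
    have ht : 0 < √τ := Real.sqrt_pos.2 hτ.1
    simp only [hgG _ hw, (hW _ hw).2, add_sub_cancel_left, smul_eq_mul,
      Real.sqrt_mul hτ.1.le]
    rw [abs_of_pos (by positivity)]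
    generalize V' (W (s + τ * (V b - s))) = p at hp ⊢
    generalize g (W (s + τ * (V b - s))) = y
    generalize √(V b - s) = r at hr hr2 ⊢
    rw [hr2]
    field_simp
  rw [← image_inverse_segment hmono hW hs]
  constructor
  · rw [integrableOn_image_iff_integrableOn_abs_deriv_smul measurableSet_Ioo hderiv hinj,
      integrableOn_congr_fun heq measurableSet_Ioo]
    exact (integrableOn_segment_mul_inv_sqrt hs (aestronglyMeasurable_segment hs hd)
      hG).const_mul _
  · rw [integral_image_eq_integral_abs_deriv_smul measurableSet_Ioo hderiv hinj,
      setIntegral_congr_fun measurableSet_Ioo heq, integral_const_mul, abelTransform]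

/-- As a function of `w = V η`, the density `V ^ p` over the derivative of `V` is differentiable and
bounded with bounded derivative. -/
lemma exists_bound_density {V'' : ℝ → ℝ} (hV : ∀ η ∈ Icc a b, HasDerivAt V (V' η) η)
    (hV' : ∀ η ∈ Icc a b, HasDerivAt V' (V'' η) η) (hV'' : ContinuousOn V'' (Icc a b))
    (hder : ∀ η ∈ Icc a b, 0 < V' η) (hpos : ∀ η ∈ Icc a b, 0 < V η)
    (hW : ∀ w ∈ Ioo (V a) (V b), W w ∈ Ioo a b ∧ V (W w) = w) (p : ℝ) :
    ∃ C, ∀ w ∈ Ioo (V a) (V b),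
      DifferentiableAt ℝ (fun w => V (W w) ^ p / V' (W w)) w ∧
      |V (W w) ^ p / V' (W w)| ≤ C ∧
      |deriv (fun w => V (W w) ^ p / V' (W w)) w| ≤ C := by
  have cV : ContinuousOn V (Icc a b) := fun η hη => (hV η hη).continuousAt.continuousWithinAt
  have cV' : ContinuousOn V' (Icc a b) := fun η hη => (hV' η hη).continuousAt.continuousWithinAt
  have cp : ∀ q : ℝ, ContinuousOn (fun η => V η ^ q) (Icc a b) := fun q =>
    cV.rpow_const fun η hη => Or.inl (hpos η hη).ne'
  have h0 : ∀ η ∈ Icc a b, V' η ≠ 0 := fun η hη => (hder η hη).ne'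
  obtain ⟨C₁, hC₁⟩ := isCompact_Icc.exists_bound_of_continuousOn ((cp p).div cV' h0)
  obtain ⟨C₂, hC₂⟩ := isCompact_Icc.exists_bound_of_continuousOn
    ((((((cV'.mul continuousOn_const).mul (cp (p - 1))).mul cV').sub ((cp p).mul hV'')).div
      (cV'.pow 2) fun η hη => pow_ne_zero 2 (h0 η hη)).mul (cV'.inv₀ h0) :
      ContinuousOn (fun η => (V' η * p * V η ^ (p - 1) * V' η - V η ^ p * V'' η) / V' η ^ 2 *
        (V' η)⁻¹) (Icc a b))
  refine ⟨max C₁ C₂, fun w hw => ?_⟩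
  have hmem := Ioo_subset_Icc_self (hW w hw).1
  have hd := (((hV _ hmem).rpow_const (p := p) (Or.inl (hpos _ hmem).ne')).div (hV' _ hmem)
    (h0 _ hmem)).comp w (hasDerivAt_inverse hV hder hW hw)
  refine ⟨hd.differentiableAt, (hC₁ _ hmem).trans (le_max_left _ _), ?_⟩
  have hderiv := hd.deriv
  simp only [Function.comp_def, Pi.div_apply] at hderiv
  rw [hderiv]
  exact (hC₂ _ hmem).trans (le_max_right _ _)

end Inverse

/-- Zero-temperature bulk-building relation: with `V` twice continuously differentiable,
increasing and positive on `[a, η₁]`, `η₀ f₀` the unique point where `V = f₀²`, and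
`Ẽ f₀ = ∫_{η₀ f₀}^{η₁} V^{3/4}/√(V − f₀²) dη`,
`R̃ f₀ = ∫_{η₀ f₀}^{η₁} f₀·V^{−1/4}/√(V − f₀²) dη`, both improper integrals converge,
`Ẽ` and `R̃` are differentiable on `(√(V a), √(V η₁))`, and `Ẽ' f₀ = f₀ · R̃' f₀`. -/
theorem stmt_7 (a η₁ : ℝ) (haη : a < η₁)
    (V V' V'' : ℝ → ℝ)
    (hV : ∀ η ∈ Set.Icc a η₁, HasDerivAt V (V' η) η)
    (hV' : ∀ η ∈ Set.Icc a η₁, HasDerivAt V' (V'' η) η)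
    (hV'' : ContinuousOn V'' (Set.Icc a η₁))
    (hder : ∀ η ∈ Set.Icc a η₁, 0 < V' η)
    (hpos : ∀ η ∈ Set.Icc a η₁, 0 < V η)
    (η₀ : ℝ → ℝ)
    (hη₀ : ∀ f₀ ∈ Set.Ioo (Real.sqrt (V a)) (Real.sqrt (V η₁)),
      η₀ f₀ ∈ Set.Ioo a η₁ ∧ V (η₀ f₀) = f₀ ^ 2) :
    ∀ f₀ ∈ Set.Ioo (Real.sqrt (V a)) (Real.sqrt (V η₁)),
      IntegrableOn (fun η => V η ^ ((3 : ℝ) / 4) / Real.sqrt (V η - f₀ ^ 2))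
        (Set.Ioo (η₀ f₀) η₁) ∧
      IntegrableOn (fun η => f₀ * V η ^ (-(1 : ℝ) / 4) / Real.sqrt (V η - f₀ ^ 2))
        (Set.Ioo (η₀ f₀) η₁) ∧
      DifferentiableAt ℝ
        (fun u => ∫ η in Set.Ioo (η₀ u) η₁,
          V η ^ ((3 : ℝ) / 4) / Real.sqrt (V η - u ^ 2)) f₀ ∧
      DifferentiableAt ℝ
        (fun u => ∫ η in Set.Ioo (η₀ u) η₁,
          u * V η ^ (-(1 : ℝ) / 4) / Real.sqrt (V η - u ^ 2)) f₀ ∧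
      deriv (fun u => ∫ η in Set.Ioo (η₀ u) η₁,
          V η ^ ((3 : ℝ) / 4) / Real.sqrt (V η - u ^ 2)) f₀ =
        f₀ * deriv (fun u => ∫ η in Set.Ioo (η₀ u) η₁,
          u * V η ^ (-(1 : ℝ) / 4) / Real.sqrt (V η - u ^ 2)) f₀ := by
  have hmono := strictMonoOn_Icc_of_hasDerivAt_pos hV hder
  have hVa : 0 < V a := hpos a (left_mem_Icc.2 haη.le)
  have hsq : ∀ u ∈ Ioo √(V a) √(V η₁), 0 < u ∧ u ^ 2 ∈ Ioo (V a) (V η₁) := fun u hu => by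
    have h0 : 0 < u := (Real.sqrt_nonneg _).trans_lt hu.1
    exact ⟨h0, (Real.sqrt_lt' h0).1 hu.1, (Real.lt_sqrt h0.le).1 hu.2⟩
  have hW : ∀ w ∈ Ioo (V a) (V η₁), η₀ √w ∈ Ioo a η₁ ∧ V (η₀ √w) = w := fun w hw => by
    have h0 : 0 < w := hVa.trans hw.1
    have h := hη₀ √w ⟨Real.sqrt_lt_sqrt hVa.le hw.1, Real.sqrt_lt_sqrt h0.le hw.2⟩
    rwa [Real.sq_sqrt h0.le] at h
  obtain ⟨C, hC⟩ := exists_bound_density (W := fun w => η₀ √w) hV hV' hV'' hder hpos hW (-1 / 4)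
  set G : ℝ → ℝ := fun w => V (η₀ √w) ^ (-(1 : ℝ) / 4) / V' (η₀ √w) with hGdef
  have hd : ∀ w ∈ Ioo (V a) (V η₁), DifferentiableAt ℝ G w := fun w hw => (hC w hw).1
  have hG : ∀ w ∈ Ioo (V a) (V η₁), |G w| ≤ C := fun w hw => (hC w hw).2.1
  have hR := fun u (hu : u ∈ Ioo √(V a) √(V η₁)) =>
    integral_div_sqrt_eq_abelTransform (W := fun w => η₀ √w) (g := fun η => V η ^ (-(1 : ℝ) / 4))
      (G := G) hV hder hW (fun _ _ => rfl) hd hG (hsq u hu).2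
  have hE := fun u (hu : u ∈ Ioo √(V a) √(V η₁)) =>
    integral_div_sqrt_eq_abelTransform (W := fun w => η₀ √w) (g := fun η => V η ^ ((3 : ℝ) / 4))
      (G := fun w => w * G w) (C := V η₁ * C) hV hder hW (fun w hw => by
        have h0 : 0 < w := hVa.trans hw.1
        simp only [hGdef, (hW w hw).2]
        rw [← mul_div_assoc, show (3 : ℝ) / 4 = 1 + -1 / 4 by norm_num, Real.rpow_add h0,
          Real.rpow_one])
      (fun w hw => differentiableAt_id.mul (hd w hw))
      (fun w hw => by
        have h0 : 0 < w := hVa.trans hw.1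
        rw [abs_mul, abs_of_pos h0]
        exact mul_le_mul hw.2.le (hG w hw) (abs_nonneg _) (h0.trans hw.2).le) (hsq u hu).2
  intro f₀ hf
  obtain ⟨hf0, hs⟩ := hsq f₀ hf
  have hnhds : Ioo √(V a) √(V η₁) ∈ 𝓝 f₀ := Ioo_mem_nhds hf.1 hf.2
  obtain ⟨d, hd1, hd2⟩ := exists_hasDerivAt_abelTransform hs hd hG fun w hw => (hC w hw).2.2
  have hpow : HasDerivAt (fun u : ℝ => u ^ 2) (2 * f₀) f₀ := by
    simpa using hasDerivAt_pow 2 f₀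
  have hRd : HasDerivAt (fun u => ∫ η in Ioo (η₀ u) η₁,
      u * V η ^ (-(1 : ℝ) / 4) / √(V η - u ^ 2))
      (abelTransform (V η₁) G (f₀ ^ 2) + f₀ * (d * (2 * f₀))) f₀ := by
    refine (((hasDerivAt_id f₀).mul (hd1.comp (h := fun u => u ^ 2) f₀ hpow)).congr_deriv
      (by simp)).congr_of_eventuallyEq ?_
    filter_upwards [hnhds] with u hu
    have h := (hR u hu).2
    rw [Real.sqrt_sq (hsq u hu).1.le] at h
    simp only [Pi.mul_apply, id, Function.comp, ← h, mul_div_assoc, integral_const_mul]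
  have hEd : HasDerivAt (fun u => ∫ η in Ioo (η₀ u) η₁, V η ^ ((3 : ℝ) / 4) / √(V η - u ^ 2))
      ((abelTransform (V η₁) G (f₀ ^ 2) / 2 + f₀ ^ 2 * d) * (2 * f₀)) f₀ := by
    refine (hd2.comp (h := fun u => u ^ 2) f₀ hpow).congr_of_eventuallyEq ?_
    filter_upwards [hnhds] with u hu
    have h := (hE u hu).2
    rw [Real.sqrt_sq (hsq u hu).1.le] at h
    exact h
  have hEi := (hE f₀ hf).1
  have hRi := (hR f₀ hf).1
  rw [Real.sqrt_sq hf0.le] at hEi hRi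
  refine ⟨hEi, ?_, hEd.differentiableAt, hRd.differentiableAt, ?_⟩
  · simp only [mul_div_assoc] at hRi ⊢
    exact hRi.const_mul f₀
  · rw [hEd.deriv, hRd.deriv]
    ring
end

section
/- Let c > 0 and define R(f₀) := √(c/f₀) for f₀ > 0. Then for every f > 0, the function f ↦ ∫_f^∞ R(f₀)/√(f₀² − f²) df₀ is differentiable, the quantity Φ(f) := −(1/π)·√f·(d/df) ∫_f^∞ R(f₀)/√(f₀² − f²) df₀ equals (Γ(5/4)/(Γ(3/4)·√π))·√c·(1/f), and consequently any function η : (0,∞) → ℝ with η'(f) = Φ(f) has the form η(f) = (L/2)·log f + const with L := 2Γ(5/4)√c/(Γ(3/4)√π), whose inverse function is f(η) = exp(2(η − η₀)/L) for some constant η₀. -/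
open MeasureTheory

/-- `G11 c f = ∫_f^∞ R(f₀)/√(f₀² − f²) df₀` with `R(f₀) = √(c/f₀)`. -/
noncomputable def G11 (c : ℝ) (f : ℝ) : ℝ :=
  ∫ f₀ in Set.Ioi f, Real.sqrt (c / f₀) / Real.sqrt (f₀ ^ 2 - f ^ 2)

/-- The AdS radius `L = 2Γ(5/4)√c/(Γ(3/4)√π)`. -/
noncomputable def L11 (c : ℝ) : ℝ :=
  2 * Real.Gamma (5 / 4) * Real.sqrt c / (Real.Gamma (3 / 4) * Real.sqrt Real.pi)

open Set in
theorem integral_Ioo_rpow_mul_one_sub_rpow {a b : ℝ} (ha : 0 < a) (hb : 0 < b) :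
    ∫ t in Ioo (0 : ℝ) 1, t ^ (a - 1) * (1 - t) ^ (b - 1) =
      Real.Gamma a * Real.Gamma b / Real.Gamma (a + b) := by
  have key : Complex.betaIntegral a b =
      ((∫ t in Ioo (0 : ℝ) 1, t ^ (a - 1) * (1 - t) ^ (b - 1) : ℝ) : ℂ) := by
    rw [Complex.betaIntegral, intervalIntegral.integral_of_le zero_le_one,
      integral_Ioc_eq_integral_Ioo, ← integral_complex_ofReal]
    refine setIntegral_congr_fun measurableSet_Ioo fun t ht => ?_
    have h1 : 0 ≤ 1 - t := by linarith [ht.2]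
    push_cast [Complex.ofReal_cpow ht.1.le, Complex.ofReal_cpow h1]
    rfl
  have h := ProbabilityTheory.beta_eq_betaIntegralReal a b ha hb
  rw [key, Complex.ofReal_re] at h
  exact h.symm

theorem image_mul_rpow_neg_half_Ioo {f : ℝ} (hf : 0 < f) :
    (fun t : ℝ => f * t ^ (-(1 / 2) : ℝ)) '' Set.Ioo 0 1 = Set.Ioi f := by
  ext y
  constructor
  · rintro ⟨t, ht, rfl⟩
    have := Real.one_lt_rpow_of_pos_of_lt_one_of_neg ht.1 ht.2 (z := -(1 / 2)) (by norm_num)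
    show f < f * t ^ (-(1 / 2) : ℝ)
    nlinarith
  · intro hy
    have hy' : f < y := hy
    have hy0 : 0 < y := hf.trans hy'
    have h1 : 1 < y / f := (one_lt_div hf).2 hy'
    refine ⟨(y / f) ^ (-2 : ℝ), ⟨by positivity,
      Real.rpow_lt_one_of_one_lt_of_neg h1 (by norm_num)⟩, ?_⟩
    show f * ((y / f) ^ (-2 : ℝ)) ^ (-(1 / 2) : ℝ) = y
    rw [← Real.rpow_mul (by positivity)]
    norm_num
    field_simp

theorem abs_deriv_mul_integrand {c f t : ℝ} (hc : 0 < c) (hf : 0 < f) (ht : t ∈ Set.Ioo (0 : ℝ) 1) :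
    |f * (-(1 / 2) * t ^ (-(1 / 2) - 1 : ℝ))| *
        (Real.sqrt (c / (f * t ^ (-(1 / 2) : ℝ))) /
          Real.sqrt ((f * t ^ (-(1 / 2) : ℝ)) ^ 2 - f ^ 2)) =
      Real.sqrt c / (2 * Real.sqrt f) * (t ^ (1 / 4 - 1 : ℝ) * (1 - t) ^ (1 / 2 - 1 : ℝ)) := by
  obtain ⟨s, hs, rfl⟩ : ∃ s : ℝ, 0 < s ∧ s ^ 4 = t :=
    ⟨t ^ (1 / 4 : ℝ), Real.rpow_pos_of_pos ht.1 _, by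
      rw [← Real.rpow_natCast, ← Real.rpow_mul ht.1.le]; norm_num⟩
  have h1 : 0 < 1 - s ^ 4 := by linarith [ht.2]
  have pow4 (r : ℝ) (n : ℕ) (hr : 4 * r = -n) : (s ^ 4) ^ r = (s ^ n)⁻¹ := by
    rw [← Real.rpow_natCast s 4, ← Real.rpow_mul hs.le, ← Real.rpow_natCast s n,
      ← Real.rpow_neg hs.le]
    congr 1
  rw [pow4 (-(1 / 2)) 2 (by norm_num), pow4 (-(1 / 2) - 1) 6 (by norm_num),
    pow4 (1 / 4 - 1) 3 (by norm_num), show (1 / 2 - 1 : ℝ) = -(1 / 2) by norm_num,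
    Real.rpow_neg h1.le, ← Real.sqrt_eq_rpow]
  have e1 : c / (f * (s ^ 2)⁻¹) = c / f * s ^ 2 := by field_simp
  have e2 : (f * (s ^ 2)⁻¹) ^ 2 - f ^ 2 = (f * (s ^ 2)⁻¹) ^ 2 * (1 - s ^ 4) := by field_simp
  rw [e1, e2, Real.sqrt_mul (by positivity), Real.sqrt_mul (by positivity), Real.sqrt_sq hs.le,
    Real.sqrt_sq (by positivity), Real.sqrt_div hc.le, abs_mul, abs_mul, abs_of_pos hf,
    abs_of_pos (a := (s ^ 6)⁻¹) (by positivity), abs_neg, abs_of_pos (a := (1 / 2 : ℝ)) (by norm_num)]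
  have hq : 0 < Real.sqrt f := Real.sqrt_pos.2 hf
  have hr : 0 < Real.sqrt (1 - s ^ 4) := Real.sqrt_pos.2 h1
  field_simp

theorem G11_eq {c f : ℝ} (hc : 0 < c) (hf : 0 < f) :
    G11 c f = 2 * Real.sqrt c * (Real.Gamma (5 / 4) * Real.sqrt Real.pi / Real.Gamma (3 / 4)) *
      f ^ (-(1 / 2) : ℝ) := by
  have hd : ∀ t ∈ Set.Ioo (0 : ℝ) 1, HasDerivWithinAt (fun t : ℝ => f * t ^ (-(1 / 2) : ℝ))
      (f * (-(1 / 2) * t ^ (-(1 / 2) - 1 : ℝ))) (Set.Ioo 0 1) t := fun t ht =>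
    ((Real.hasDerivAt_rpow_const (Or.inl ht.1.ne')).const_mul f).hasDerivWithinAt
  have hinj : Set.InjOn (fun t : ℝ => f * t ^ (-(1 / 2) : ℝ)) (Set.Ioo 0 1) := by
    intro x hx y hy hxy
    exact (Real.rpow_left_inj hx.1.le hy.1.le (by norm_num)).1 (mul_left_cancel₀ hf.ne' hxy)
  rw [G11, ← image_mul_rpow_neg_half_Ioo hf,
    integral_image_eq_integral_abs_deriv_smul measurableSet_Ioo hd hinj]
  simp only [smul_eq_mul]
  rw [setIntegral_congr_fun measurableSet_Ioo fun t ht => abs_deriv_mul_integrand hc hf ht,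
    integral_const_mul, integral_Ioo_rpow_mul_one_sub_rpow (by norm_num) (by norm_num),
    Real.Gamma_one_half_eq, show (1 / 4 + 1 / 2 : ℝ) = 3 / 4 by norm_num,
    show (5 / 4 : ℝ) = 1 / 4 + 1 by norm_num, Real.Gamma_add_one (by norm_num),
    Real.rpow_neg hf.le, ← Real.sqrt_eq_rpow]
  have hq : 0 < Real.sqrt f := Real.sqrt_pos.2 hf
  have hG : 0 < Real.Gamma (3 / 4) := Real.Gamma_pos_of_pos (by norm_num)
  field_simp
  norm_num

theorem hasDerivAt_G11 {c f : ℝ} (hc : 0 < c) (hf : 0 < f) :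
    HasDerivAt (G11 c)
      (2 * Real.sqrt c * (Real.Gamma (5 / 4) * Real.sqrt Real.pi / Real.Gamma (3 / 4)) *
        (-(1 / 2) * f ^ (-(1 / 2) - 1 : ℝ))) f := by
  refine HasDerivAt.congr_of_eventuallyEq
    ((Real.hasDerivAt_rpow_const (Or.inl hf.ne')).const_mul _) ?_
  filter_upwards [Ioi_mem_nhds hf] with x hx using G11_eq hc hx

theorem bulk_quantity_eq {c f : ℝ} (hc : 0 < c) (hf : 0 < f) :
    -(1 / Real.pi) * Real.sqrt f * deriv (G11 c) f =
      Real.Gamma (5 / 4) / (Real.Gamma (3 / 4) * Real.sqrt Real.pi) * Real.sqrt c * (1 / f) := by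
  rw [(hasDerivAt_G11 hc hf).deriv, Real.rpow_sub_one hf.ne', Real.rpow_neg hf.le,
    ← Real.sqrt_eq_rpow]
  have hq : 0 < Real.sqrt f := Real.sqrt_pos.2 hf
  have hG : 0 < Real.Gamma (3 / 4) := Real.Gamma_pos_of_pos (by norm_num)
  have hp : 0 < Real.sqrt Real.pi := Real.sqrt_pos.2 Real.pi_pos
  have hpi : Real.sqrt Real.pi ^ 2 = Real.pi := Real.sq_sqrt Real.pi_pos.le
  field_simp
  rw [hpi]

/-- For the conformal potential data `R(f₀) = √(c/f₀)`, the bulk-building quantity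
`Φ f = −(1/π)·√f·(d/df)∫_f^∞ R(f₀)/√(f₀² − f²) df₀` is well defined and equals
`(Γ(5/4)/(Γ(3/4)√π))·√c·(1/f)`; consequently any `η` with `η' = Φ` on `(0, ∞)` has the
form `η f = (L/2)·log f + η₀` with inverse `f(η) = exp(2(η − η₀)/L)`. -/
theorem stmt_11 (c : ℝ) (hc : 0 < c) :
    (∀ f : ℝ, 0 < f →
      DifferentiableAt ℝ (G11 c) f ∧
      -(1 / Real.pi) * Real.sqrt f * deriv (G11 c) f =
        Real.Gamma (5 / 4) / (Real.Gamma (3 / 4) * Real.sqrt Real.pi) * Real.sqrt c *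
          (1 / f)) ∧
    ∀ η : ℝ → ℝ,
      (∀ f : ℝ, 0 < f →
        HasDerivAt η (-(1 / Real.pi) * Real.sqrt f * deriv (G11 c) f) f) →
      ∃ η₀ : ℝ, ∀ f : ℝ, 0 < f →
        η f = L11 c / 2 * Real.log f + η₀ ∧
        Real.exp (2 * (η f - η₀) / L11 c) = f := by
  refine ⟨fun f hf => ⟨(hasDerivAt_G11 hc hf).differentiableAt, bulk_quantity_eq hc hf⟩,
    fun η hη => ?_⟩
  have hlog (f : ℝ) (hf : 0 < f) :
      HasDerivAt (fun x => L11 c / 2 * Real.log x) (L11 c / 2 * f⁻¹) f :=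
    (Real.hasDerivAt_log hf.ne').const_mul _
  obtain ⟨η₀, h⟩ := isOpen_Ioi.exists_eq_add_of_deriv_eq (s := Set.Ioi (0 : ℝ)) isPreconnected_Ioi
    (fun f hf => (hη f hf).differentiableAt.differentiableWithinAt)
    (fun f hf => (hlog f hf).differentiableAt.differentiableWithinAt) fun f hf => by
      rw [(hη f hf).deriv, (hlog f hf).deriv, bulk_quantity_eq hc hf, L11]
      ring
  have hL : 0 < L11 c := by
    have h1 : 0 < Real.Gamma (5 / 4) := Real.Gamma_pos_of_pos (by norm_num)
    have h2 : 0 < Real.Gamma (3 / 4) := Real.Gamma_pos_of_pos (by norm_num)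
    unfold L11
    positivity
  refine ⟨η₀, fun f hf => ⟨h hf, ?_⟩⟩
  have e : 2 * (η f - η₀) / L11 c = Real.log f := by
    rw [h hf]
    field_simp
    ring
  rw [e, Real.exp_log hf]
end

section
/- Let n > 0 be real, and for s ∈ (0, 1) define I(s) := ∫_1^∞ x/((x − s)^{1 + 1/n}·√(x² − 1)) dx (a convergent improper integral). Then lim_{s → 1⁻} (1 − s)^{1/2 + 1/n}·I(s) = √(π/2)·Γ(1/2 + 1/n)/Γ(1 + 1/n), where Γ is the Gamma function. -/
open MeasureTheory

open Set Filter Topology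

theorem ofReal_rpow_mul_one_sub_rpow (a b : ℝ) {t : ℝ} (ht : t ∈ Ioo (0 : ℝ) 1) :
    ((t : ℂ) ^ ((a : ℂ) - 1) * (1 - (t : ℂ)) ^ ((b : ℂ) - 1)) =
      ((t ^ (a - 1) * (1 - t) ^ (b - 1) : ℝ) : ℂ) := by
  have h : (0 : ℝ) ≤ 1 - t := by linarith [ht.2]
  rw [Complex.ofReal_mul, Complex.ofReal_cpow ht.1.le, Complex.ofReal_cpow h]
  push_cast
  rfl

theorem integrableOn_rpow_mul_one_sub_rpow {a b : ℝ} (ha : 0 < a) (hb : 0 < b) :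
    IntegrableOn (fun t : ℝ => t ^ (a - 1) * (1 - t) ^ (b - 1)) (Ioo 0 1) := by
  have h := Complex.betaIntegral_convergent (u := a) (v := b) (by simpa) (by simpa)
  rw [intervalIntegrable_iff_integrableOn_Ioo_of_le zero_le_one] at h
  refine IntegrableOn.congr_fun h.re (fun t ht => ?_) measurableSet_Ioo
  rw [ofReal_rpow_mul_one_sub_rpow a b ht]
  rfl

theorem integral_rpow_mul_one_sub_rpow {a b : ℝ} (ha : 0 < a) (hb : 0 < b) :
    ∫ t in Ioo (0 : ℝ) 1, t ^ (a - 1) * (1 - t) ^ (b - 1) = ProbabilityTheory.beta a b := by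
  rw [ProbabilityTheory.beta_eq_betaIntegralReal a b ha hb, Complex.betaIntegral,
    intervalIntegral.integral_of_le zero_le_one, integral_Ioc_eq_integral_Ioo,
    setIntegral_congr_fun measurableSet_Ioo
      (fun t ht => ofReal_rpow_mul_one_sub_rpow a b ht), integral_complex_ofReal,
    Complex.ofReal_re]

theorem image_div_one_sub_Ioo : (fun t : ℝ => t / (1 - t)) '' Ioo 0 1 = Ioi 0 := by
  ext u
  constructor
  · rintro ⟨t, ht, rfl⟩
    exact div_pos ht.1 (sub_pos.2 ht.2)
  · intro hu
    have hu : 0 < u := hu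
    refine ⟨u / (1 + u), ⟨by positivity, by rw [div_lt_one (by positivity)]; linarith⟩, ?_⟩
    have : 1 - u / (1 + u) = 1 / (1 + u) := by field_simp; ring
    simp only [this]
    field_simp

theorem injOn_div_one_sub_Ioo : InjOn (fun t : ℝ => t / (1 - t)) (Ioo 0 1) := by
  intro x hx y hy h
  have hx' : 1 - x ≠ 0 := (sub_pos.2 hx.2).ne'
  have hy' : 1 - y ≠ 0 := (sub_pos.2 hy.2).ne'
  simp only [div_eq_div_iff hx' hy'] at h
  linarith

theorem hasDerivWithinAt_div_one_sub {t : ℝ} (ht : t ∈ Ioo (0 : ℝ) 1) :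
    HasDerivWithinAt (fun t : ℝ => t / (1 - t)) (((1 - t) ^ 2)⁻¹) (Ioo 0 1) t := by
  have h : 1 - t ≠ 0 := (sub_pos.2 ht.2).ne'
  have := ((hasDerivAt_id t).div ((hasDerivAt_id t).const_sub 1) h).hasDerivWithinAt
    (s := Ioo 0 1)
  convert! this using 1
  simp only [id]
  field_simp
  ring

theorem abs_deriv_smul_rpow_mul_one_add_rpow (a b : ℝ) {t : ℝ} (ht : t ∈ Ioo (0 : ℝ) 1) :
    |((1 - t) ^ 2)⁻¹| • ((t / (1 - t)) ^ (a - 1) * (1 + t / (1 - t)) ^ (-(a + b))) =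
      t ^ (a - 1) * (1 - t) ^ (b - 1) := by
  have h : 0 < 1 - t := sub_pos.2 ht.2
  have h1 : 1 + t / (1 - t) = (1 - t)⁻¹ := by field_simp; ring
  rw [abs_of_pos (by positivity), smul_eq_mul, h1, Real.inv_rpow h.le,
    Real.rpow_neg h.le, inv_inv, Real.div_rpow ht.1.le h.le, ← Real.rpow_natCast,
    div_eq_mul_inv, ← Real.rpow_neg h.le, ← Real.rpow_neg h.le]
  calc _ = t ^ (a - 1) *
        ((1 - t) ^ (-((2 : ℕ) : ℝ)) * (1 - t) ^ (-(a - 1)) * (1 - t) ^ (a + b)) := by ring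
    _ = _ := by
        rw [← Real.rpow_add h, ← Real.rpow_add h]
        congr 2
        push_cast
        ring

theorem integrableOn_rpow_mul_one_add_rpow {a b : ℝ} (ha : 0 < a) (hb : 0 < b) :
    IntegrableOn (fun u : ℝ => u ^ (a - 1) * (1 + u) ^ (-(a + b))) (Ioi 0) := by
  rw [← image_div_one_sub_Ioo, integrableOn_image_iff_integrableOn_abs_deriv_smul
    measurableSet_Ioo (fun _ => hasDerivWithinAt_div_one_sub) injOn_div_one_sub_Ioo]
  exact (integrableOn_rpow_mul_one_sub_rpow ha hb).congr_fun
    (fun t ht => (abs_deriv_smul_rpow_mul_one_add_rpow a b ht).symm) measurableSet_Ioo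

theorem integral_rpow_mul_one_add_rpow {a b : ℝ} (ha : 0 < a) (hb : 0 < b) :
    ∫ u in Ioi (0 : ℝ), u ^ (a - 1) * (1 + u) ^ (-(a + b)) = ProbabilityTheory.beta a b := by
  rw [← image_div_one_sub_Ioo, integral_image_eq_integral_abs_deriv_smul
    measurableSet_Ioo (fun _ => hasDerivWithinAt_div_one_sub) injOn_div_one_sub_Ioo,
    ← integral_rpow_mul_one_sub_rpow ha hb]
  exact setIntegral_congr_fun measurableSet_Ioo
    (fun t ht => abs_deriv_smul_rpow_mul_one_add_rpow a b ht)

/-- The integrand in the variable `u = (x - 1) / ε`, where `ε = 1 - s`, after extracting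
powers of `ε`. -/
noncomputable def rescaledIntegrand (p ε u : ℝ) : ℝ :=
  (1 + ε * u) / Real.sqrt (2 + ε * u) * (u ^ ((1 / 2 : ℝ) - 1) * (1 + u) ^ (-p))

theorem aestronglyMeasurable_rescaledIntegrand (p ε : ℝ) (μ : Measure ℝ) :
    AEStronglyMeasurable (rescaledIntegrand p ε) μ := by
  unfold rescaledIntegrand
  exact Measurable.aestronglyMeasurable (by fun_prop)

theorem norm_rescaledIntegrand_le (p : ℝ) {ε u : ℝ} (hε : ε ∈ Ioo (0 : ℝ) 1) (hu : 0 < u) :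
    ‖rescaledIntegrand p ε u‖ ≤ u ^ ((1 / 2 : ℝ) - 1) * (1 + u) ^ (-(p - 1 / 2)) := by
  have h0 : 0 < ε * u := mul_pos hε.1 hu
  have h1 : ε * u ≤ u := by nlinarith [hε.2]
  have hb : (1 + ε * u) / Real.sqrt (2 + ε * u) ≤ (1 + u) ^ (1 / 2 : ℝ) := by
    rw [← Real.sqrt_eq_rpow, div_le_iff₀ (by positivity)]
    calc 1 + ε * u = Real.sqrt (1 + ε * u) * Real.sqrt (1 + ε * u) :=
          (Real.mul_self_sqrt (by positivity)).symm
      _ ≤ _ := by gcongr; norm_num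
  rw [rescaledIntegrand, Real.norm_of_nonneg (by positivity)]
  calc _ ≤ (1 + u) ^ (1 / 2 : ℝ) * (u ^ ((1 / 2 : ℝ) - 1) * (1 + u) ^ (-p)) := by gcongr
    _ = u ^ ((1 / 2 : ℝ) - 1) * ((1 + u) ^ (1 / 2 : ℝ) * (1 + u) ^ (-p)) := by ring
    _ = _ := by
        rw [← Real.rpow_add (by positivity)]
        congr 2
        ring

theorem integrableOn_rescaledIntegrand_bound {p : ℝ} (hp : 1 < p) :
    IntegrableOn (fun u : ℝ => u ^ ((1 / 2 : ℝ) - 1) * (1 + u) ^ (-(p - 1 / 2))) (Ioi 0) := by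
  have := integrableOn_rpow_mul_one_add_rpow (a := 1 / 2) (b := p - 1) (by norm_num) (by linarith)
  convert this using 5
  ring

theorem integrableOn_rescaledIntegrand {p ε : ℝ} (hp : 1 < p) (hε : ε ∈ Ioo (0 : ℝ) 1) :
    IntegrableOn (rescaledIntegrand p ε) (Ioi 0) :=
  (integrableOn_rescaledIntegrand_bound hp).mono'
    (aestronglyMeasurable_rescaledIntegrand p ε _)
    ((ae_restrict_mem measurableSet_Ioi).mono fun _ hu => norm_rescaledIntegrand_le p hε hu)

theorem tendsto_integral_rescaledIntegrand {p : ℝ} (hp : 1 < p) :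
    Tendsto (fun ε => ∫ u in Ioi (0 : ℝ), rescaledIntegrand p ε u) (𝓝[>] 0)
      (𝓝 ((Real.sqrt 2)⁻¹ * ProbabilityTheory.beta (1 / 2) (p - 1 / 2))) := by
  have hlim : (Real.sqrt 2)⁻¹ * ProbabilityTheory.beta (1 / 2) (p - 1 / 2) =
      ∫ u in Ioi (0 : ℝ), rescaledIntegrand p 0 u := by
    rw [← integral_rpow_mul_one_add_rpow (by norm_num) (by linarith), ← integral_const_mul]
    simp [rescaledIntegrand]
  rw [hlim]
  refine tendsto_integral_filter_of_dominated_convergence _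
    (Eventually.of_forall fun ε => aestronglyMeasurable_rescaledIntegrand p ε _)
    ?_ (integrableOn_rescaledIntegrand_bound hp) (Eventually.of_forall fun u => ?_)
  · filter_upwards [Ioo_mem_nhdsGT one_pos] with ε hε
    exact (ae_restrict_mem measurableSet_Ioi).mono fun _ hu => norm_rescaledIntegrand_le p hε hu
  · have : ContinuousAt (fun ε => rescaledIntegrand p ε u) 0 := by
      unfold rescaledIntegrand
      refine ContinuousAt.mul (ContinuousAt.div (by fun_prop) (by fun_prop) ?_)
        continuousAt_const
      simp
    exact this.tendsto.mono_left nhdsWithin_le_nhds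

theorem image_one_add_mul_Ioi {ε : ℝ} (hε : 0 < ε) :
    (fun u : ℝ => 1 + ε * u) '' Ioi 0 = Ioi 1 := by
  ext x
  constructor
  · rintro ⟨u, hu, rfl⟩
    have := mul_pos hε hu
    simpa using this
  · intro hx
    refine ⟨(x - 1) / ε, div_pos (sub_pos.2 hx) hε, ?_⟩
    field_simp
    ring

theorem injOn_one_add_mul {ε : ℝ} (hε : 0 < ε) (s : Set ℝ) :
    InjOn (fun u : ℝ => 1 + ε * u) s := by
  intro x _ y _ h
  exact mul_left_cancel₀ hε.ne' (add_left_cancel h)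

theorem hasDerivWithinAt_one_add_mul (ε u : ℝ) (s : Set ℝ) :
    HasDerivWithinAt (fun u : ℝ => 1 + ε * u) ε s u := by
  simpa using (((hasDerivAt_id u).const_mul ε).const_add 1).hasDerivWithinAt (s := s)

theorem abs_smul_integrand_eq_rescaledIntegrand (p : ℝ) {ε u : ℝ} (hε : 0 < ε) (hu : 0 < u) :
    |ε| • ((1 + ε * u) / ((1 + ε * u - (1 - ε)) ^ p * Real.sqrt ((1 + ε * u) ^ 2 - 1))) =
      ε ^ (1 / 2 - p) * rescaledIntegrand p ε u := by
  have h1 : 1 + ε * u - (1 - ε) = ε * (1 + u) := by ring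
  have h2 : (1 + ε * u) ^ 2 - 1 = ε * (u * (2 + ε * u)) := by ring
  have h3 : u ^ ((1 / 2 : ℝ) - 1) = (Real.sqrt u)⁻¹ := by
    rw [Real.sqrt_eq_rpow, ← Real.rpow_neg hu.le]
    norm_num
  have h4 : ε ^ (1 / 2 - p) = Real.sqrt ε / ε ^ p := by
    rw [Real.sqrt_eq_rpow, ← Real.rpow_sub hε]
  have h5 : Real.sqrt ε ^ 2 = ε := Real.sq_sqrt hε.le
  have hs : 0 < Real.sqrt (2 + ε * u) := by positivity
  rw [abs_of_pos hε, smul_eq_mul, h1, h2, rescaledIntegrand, h3, h4,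
    Real.mul_rpow hε.le (by positivity), Real.sqrt_mul hε.le, Real.sqrt_mul hu.le,
    Real.rpow_neg (by positivity)]
  field_simp
  rw [h5]

theorem integrableOn_integrand {p s : ℝ} (hp : 1 < p) (hs : s ∈ Ioo (0 : ℝ) 1) :
    IntegrableOn (fun x : ℝ => x / ((x - s) ^ p * Real.sqrt (x ^ 2 - 1))) (Ioi 1) := by
  have hε : 1 - s ∈ Ioo (0 : ℝ) 1 := ⟨sub_pos.2 hs.2, by linarith [hs.1]⟩
  rw [← image_one_add_mul_Ioi hε.1, integrableOn_image_iff_integrableOn_abs_deriv_smul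
    measurableSet_Ioi (fun u _ => hasDerivWithinAt_one_add_mul _ u _) (injOn_one_add_mul hε.1 _)]
  refine IntegrableOn.congr_fun
    ((integrableOn_rescaledIntegrand hp hε).const_mul ((1 - s) ^ (1 / 2 - p)))
    (fun u hu => ?_) measurableSet_Ioi
  simpa using (abs_smul_integrand_eq_rescaledIntegrand p hε.1 hu).symm

theorem integral_integrand (p : ℝ) {s : ℝ} (hs : s < 1) :
    ∫ x in Ioi (1 : ℝ), x / ((x - s) ^ p * Real.sqrt (x ^ 2 - 1)) =
      (1 - s) ^ (1 / 2 - p) * ∫ u in Ioi (0 : ℝ), rescaledIntegrand p (1 - s) u := by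
  have hε : 0 < 1 - s := sub_pos.2 hs
  rw [← image_one_add_mul_Ioi hε, integral_image_eq_integral_abs_deriv_smul
    measurableSet_Ioi (fun u _ => hasDerivWithinAt_one_add_mul _ u _) (injOn_one_add_mul hε _),
    ← integral_const_mul]
  refine setIntegral_congr_fun measurableSet_Ioi (fun u hu => ?_)
  simpa using abs_smul_integrand_eq_rescaledIntegrand p hε hu



/-- For `n > 0` and `I s = ∫_1^∞ x/((x − s)^(1 + 1/n)·√(x² − 1)) dx` (a convergent improper
integral for `s ∈ (0, 1)`), one has
`lim_{s → 1⁻} (1 − s)^(1/2 + 1/n)·I s = √(π/2)·Γ(1/2 + 1/n)/Γ(1 + 1/n)`. -/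
theorem stmt_14 (n : ℝ) (hn : 0 < n) :
    (∀ s ∈ Set.Ioo (0 : ℝ) 1,
      IntegrableOn
        (fun x : ℝ => x / ((x - s) ^ (1 + 1 / n : ℝ) * Real.sqrt (x ^ 2 - 1)))
        (Set.Ioi 1)) ∧
    Filter.Tendsto
      (fun s : ℝ => (1 - s) ^ (1 / 2 + 1 / n : ℝ) *
        ∫ x in Set.Ioi (1 : ℝ), x / ((x - s) ^ (1 + 1 / n : ℝ) * Real.sqrt (x ^ 2 - 1)))
      (nhdsWithin 1 (Set.Iio 1))
      (nhds (Real.sqrt (Real.pi / 2) * Real.Gamma (1 / 2 + 1 / n) / Real.Gamma (1 + 1 / n))) := by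
  have hp : 1 < 1 + 1 / n := by linarith [one_div_pos.2 hn]
  refine ⟨fun s hs => integrableOn_integrand hp hs, ?_⟩
  have hconst : Real.sqrt (Real.pi / 2) * Real.Gamma (1 / 2 + 1 / n) / Real.Gamma (1 + 1 / n) =
      (Real.sqrt 2)⁻¹ * ProbabilityTheory.beta (1 / 2) (1 + 1 / n - 1 / 2) := by
    rw [ProbabilityTheory.beta, Real.Gamma_one_half_eq, Real.sqrt_div Real.pi_pos.le,
      show (1 : ℝ) + 1 / n - 1 / 2 = 1 / 2 + 1 / n by ring,
      show (1 / 2 : ℝ) + (1 / 2 + 1 / n) = 1 + 1 / n by ring]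
    ring
  rw [hconst]
  have hsub : Tendsto (fun s : ℝ => 1 - s) (𝓝[<] 1) (𝓝[>] 0) := by
    refine tendsto_nhdsWithin_iff.2 ⟨?_, ?_⟩
    · have : ContinuousAt (fun s : ℝ => 1 - s) 1 := by fun_prop
      simpa using this.tendsto.mono_left (nhdsWithin_le_nhds (s := Iio 1))
    · filter_upwards [self_mem_nhdsWithin] with s (hs : s < 1)
      exact sub_pos.2 hs
  refine ((tendsto_integral_rescaledIntegrand hp).comp hsub).congr' ?_
  filter_upwards [self_mem_nhdsWithin] with s (hs : s < 1)
  rw [integral_integrand _ hs, ← mul_assoc, ← Real.rpow_add (sub_pos.2 hs),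
    show (1 / 2 + 1 / n + (1 / 2 - (1 + 1 / n)) : ℝ) = 0 by ring, Real.rpow_zero, one_mul]
  rfl
end

section
/- Let σ̃ > 0, c̃ > 0 and n > 0 be real, and define R(f₀) := ((f₀ − σ̃)/c̃)^{−1/n} for f₀ > σ̃. Then for every f > σ̃ the quantity Φ(f) := −(1/π)·√f·(d/df) ∫_f^∞ R(f₀)/√(f₀² − f²) df₀ is well defined, and lim_{f → σ̃⁺} (f − σ̃)^{1/2 + 1/n}·Φ(f) = (c̃^{1/n}/(n·√(2π)))·Γ(1/2 + 1/n)/Γ(1 + 1/n), where Γ is the Gamma function. In particular Φ(f) → +∞ as f → σ̃⁺. -/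
open MeasureTheory

/-- `G15 σ c n f = ∫_f^∞ R(f₀)/√(f₀² − f²) df₀` with `R(f₀) = ((f₀ − σ)/c)^(−1/n)`. -/
noncomputable def G15 (σ c n : ℝ) (f : ℝ) : ℝ :=
  ∫ f₀ in Set.Ioi f, ((f₀ - σ) / c) ^ (-(1 : ℝ) / n) / Real.sqrt (f₀ ^ 2 - f ^ 2)

/-- `Φ15 σ c n f = −(1/π)·√f·(d/df) G15 σ c n f`. -/
noncomputable def Φ15 (σ c n : ℝ) (f : ℝ) : ℝ :=
  -(1 / Real.pi) * Real.sqrt f * deriv (G15 σ c n) f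

open Set Filter Topology

/-- The beta integral in its form over the half-line. -/
theorem integral_Ioi_rpow_mul_one_add_rpow {s r : ℝ} (hs : 0 < s) (hr : 0 < r) :
    ∫ t in Ioi (0 : ℝ), t ^ (s - 1) * (1 + t) ^ (-(s + r)) =
      Real.Gamma s * Real.Gamma r / Real.Gamma (s + r) := by
  have himg : (fun y : ℝ => y / (1 - y)) '' Ioo 0 1 = Ioi 0 := by
    ext t
    constructor
    · rintro ⟨y, ⟨h0, h1⟩, rfl⟩
      exact div_pos h0 (by linarith)
    · intro ht
      have ht : 0 < t := ht
      refine ⟨t / (1 + t), ⟨by positivity, ?_⟩, ?_⟩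
      · rw [div_lt_one (by positivity)]; linarith
      · have h : 1 - t / (1 + t) = 1 / (1 + t) := by field_simp; ring
        simp only [h]
        field_simp
  have hderiv : ∀ y ∈ Ioo (0 : ℝ) 1,
      HasDerivWithinAt (fun y : ℝ => y / (1 - y)) (1 / (1 - y) ^ 2) (Ioo 0 1) y := by
    intro y hy
    have h1 : (1 : ℝ) - y ≠ 0 := by linarith [hy.2]
    have h := ((hasDerivAt_id y).div ((hasDerivAt_id y).const_sub 1) h1).hasDerivWithinAt
      (s := Ioo 0 1)
    refine h.congr_deriv ?_
    simp
  have hinj : InjOn (fun y : ℝ => y / (1 - y)) (Ioo 0 1) := by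
    intro x hx y hy hxy
    have h1 : (1 : ℝ) - x ≠ 0 := by linarith [hx.2]
    have h2 : (1 : ℝ) - y ≠ 0 := by linarith [hy.2]
    have hxy : x / (1 - x) = y / (1 - y) := hxy
    rw [div_eq_div_iff h1 h2] at hxy
    linarith
  rw [← himg, integral_image_eq_integral_abs_deriv_smul measurableSet_Ioo hderiv hinj]
  have hbeta := ProbabilityTheory.beta_eq_betaIntegralReal s r hs hr
  rw [ProbabilityTheory.beta] at hbeta
  rw [hbeta, Complex.betaIntegral, intervalIntegral.integral_of_le zero_le_one,
    integral_Ioc_eq_integral_Ioo]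
  have hcongr : ∫ x in Ioo (0 : ℝ) 1, (x : ℂ) ^ ((s : ℂ) - 1) * (1 - (x : ℂ)) ^ ((r : ℂ) - 1) =
      ∫ x in Ioo (0 : ℝ) 1, ((x ^ (s - 1) * (1 - x) ^ (r - 1) : ℝ) : ℂ) := by
    refine setIntegral_congr_fun measurableSet_Ioo fun x hx => ?_
    have h1 : 0 ≤ 1 - x := by linarith [hx.2]
    simp only [Complex.ofReal_mul]
    rw [Complex.ofReal_cpow hx.1.le, Complex.ofReal_cpow h1]
    push_cast
    rfl
  rw [hcongr, integral_complex_ofReal, Complex.ofReal_re]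
  refine setIntegral_congr_fun measurableSet_Ioo fun x hx => ?_
  have h0 : 0 < x := hx.1
  have h1 : 0 < 1 - x := by linarith [hx.2]
  have h2 : 1 + x / (1 - x) = (1 - x)⁻¹ := by field_simp; ring
  simp only [smul_eq_mul]
  rw [h2, abs_of_pos (by positivity), Real.div_rpow h0.le h1.le, Real.inv_rpow h1.le,
    ← Real.rpow_neg h1.le, neg_neg, one_div, div_eq_mul_inv, ← Real.rpow_neg h1.le,
    ← Real.rpow_natCast, ← Real.rpow_neg h1.le]
  have h3 : r - 1 = -((2 : ℕ) : ℝ) + (-(s - 1)) + (s + r) := by push_cast; ring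
  rw [h3, Real.rpow_add h1 _ (s + r), Real.rpow_add h1 (-((2 : ℕ) : ℝ))]
  ring

theorem integrableOn_Ioi_rpow_mul_one_add_rpow {a : ℝ} (ha : 0 < a) :
    IntegrableOn (fun t : ℝ => t ^ (-(1 / 2) : ℝ) * (1 + t) ^ (-(a + 1 / 2))) (Ioi 0) := by
  have hmeas : Measurable (fun t : ℝ => t ^ (-(1 / 2) : ℝ) * (1 + t) ^ (-(a + 1 / 2))) := by
    fun_prop
  rw [← Ioc_union_Ioi_eq_Ioi zero_le_one]
  refine IntegrableOn.union ?_ ?_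
  · have h : IntegrableOn (fun t : ℝ => t ^ (-(1 / 2) : ℝ)) (Ioc 0 1) := by
      rw [← intervalIntegrable_iff_integrableOn_Ioc_of_le zero_le_one]
      exact intervalIntegral.intervalIntegrable_rpow' (by norm_num)
    refine Integrable.mono' h hmeas.aestronglyMeasurable ?_
    refine (ae_restrict_iff' measurableSet_Ioc).2 (Eventually.of_forall fun t ht => ?_)
    have h0 : 0 < t := ht.1
    rw [Real.norm_of_nonneg (by positivity)]
    exact mul_le_of_le_one_right (by positivity)
      (Real.rpow_le_one_of_one_le_of_nonpos (by linarith) (by linarith))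
  · have h : IntegrableOn (fun t : ℝ => t ^ (-(a + 1))) (Ioi 1) :=
      integrableOn_Ioi_rpow_of_lt (by linarith) one_pos
    refine Integrable.mono' h hmeas.aestronglyMeasurable ?_
    refine (ae_restrict_iff' measurableSet_Ioi).2 (Eventually.of_forall fun t ht => ?_)
    have h0 : 0 < t := lt_trans one_pos ht
    rw [Real.norm_of_nonneg (by positivity)]
    have h1 : -(a + 1) = -(1 / 2) + -(a + 1 / 2) := by ring
    rw [h1, Real.rpow_add h0]
    gcongr ?_ * ?_
    exact Real.rpow_le_rpow_of_nonpos h0 (by linarith) (by linarith)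

theorem rpow_neg_div_sqrt_le {p k v y : ℝ} (hp : 0 ≤ p) (hk : 0 < k) (hv : 0 < v)
    (hy : k * (1 + v) ≤ y) :
    y ^ (-p) / √(v * (v + 2)) ≤
      k ^ (-p) * (v ^ (-(1 / 2) : ℝ) * (1 + v) ^ (-(p + 1 / 2))) := by
  have h1 : y ^ (-p) ≤ k ^ (-p) * (1 + v) ^ (-p) := by
    rw [← Real.mul_rpow hk.le (by positivity)]
    exact Real.rpow_le_rpow_of_nonpos (by positivity) hy (by linarith)
  have h2 : (√(v * (v + 2)))⁻¹ ≤ v ^ (-(1 / 2) : ℝ) * (1 + v) ^ (-(1 / 2) : ℝ) := by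
    rw [← Real.mul_rpow hv.le (by positivity), Real.rpow_neg (by positivity),
      ← Real.sqrt_eq_rpow]
    refine inv_anti₀ (by positivity) (Real.sqrt_le_sqrt ?_)
    exact mul_le_mul_of_nonneg_left (by linarith) hv.le
  have h3 : -(p + 1 / 2) = -p + -(1 / 2) := by ring
  rw [h3, Real.rpow_add (by positivity), div_eq_mul_inv]
  calc y ^ (-p) * (√(v * (v + 2)))⁻¹
      ≤ (k ^ (-p) * (1 + v) ^ (-p)) * (v ^ (-(1 / 2) : ℝ) * (1 + v) ^ (-(1 / 2) : ℝ)) := by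
        gcongr
    _ = _ := by ring

theorem G15_eq {σ c n f : ℝ} (hσ : 0 < σ) (hc : 0 < c) (hf : σ < f) :
    G15 σ c n f = c ^ (1 / n) *
      ∫ v in Ioi (0 : ℝ), (f - σ + f * v) ^ (-(1 / n)) / √(v * (v + 2)) := by
  have hf0 : 0 < f := hσ.trans hf
  have himg : (fun v : ℝ => f + f * v) '' Ioi 0 = Ioi f := by
    ext x
    constructor
    · rintro ⟨v, hv, rfl⟩
      have hv : 0 < v := hv
      have : 0 < f * v := by positivity
      simp only [mem_Ioi]; linarith
    · intro hx
      have hx : f < x := hx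
      refine ⟨(x - f) / f, div_pos (by linarith) hf0, ?_⟩
      simp only
      field_simp
      ring
  have hderiv : ∀ v ∈ Ioi (0 : ℝ), HasDerivWithinAt (fun v : ℝ => f + f * v) f (Ioi 0) v := by
    intro v _
    simpa using (((hasDerivAt_id v).const_mul f).const_add f).hasDerivWithinAt (s := Ioi 0)
  have hinj : InjOn (fun v : ℝ => f + f * v) (Ioi 0) := by
    intro x _ y _ hxy
    have hxy : f + f * x = f + f * y := hxy
    exact mul_left_cancel₀ hf0.ne' (add_left_cancel hxy)
  rw [G15, ← himg, integral_image_eq_integral_abs_deriv_smul measurableSet_Ioi hderiv hinj,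
    ← integral_const_mul]
  refine setIntegral_congr_fun measurableSet_Ioi fun v hv => ?_
  have hv : 0 < v := hv
  have h1 : 0 < f - σ + f * v := by have := sub_pos.2 hf; positivity
  have h2 : (f + f * v) ^ 2 - f ^ 2 = f ^ 2 * (v * (v + 2)) := by ring
  have h3 : f + f * v - σ = f - σ + f * v := by ring
  have h4 : -(1 : ℝ) / n = -(1 / n) := by ring
  simp only [smul_eq_mul]
  rw [h2, h3, h4, Real.sqrt_mul (by positivity), Real.sqrt_sq hf0.le, abs_of_pos hf0,
    Real.div_rpow h1.le hc.le, Real.rpow_neg hc.le]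
  have h5 : 0 < √(v * (v + 2)) := by positivity
  have h6 : 0 < c ^ (1 / n) := by positivity
  field_simp

theorem hasDerivAt_integral_shifted_rpow {σ a f : ℝ} (hσ : 0 < σ) (ha : 0 < a) (hf : σ < f) :
    HasDerivAt
      (fun g : ℝ => ∫ v in Ioi (0 : ℝ), (g - σ + g * v) ^ (-a) / √(v * (v + 2)))
      (∫ v in Ioi (0 : ℝ),
        -a * ((1 + v) * (f - σ + f * v) ^ (-(a + 1)) / √(v * (v + 2)))) f := by
  set k := (f - σ) / 2 with hk
  have hk0 : 0 < k := by rw [hk]; linarith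
  have hs : Ioi (σ + k) ∈ 𝓝 f := Ioi_mem_nhds (by rw [hk]; linarith)
  have hlow : ∀ g ∈ Ioi (σ + k), ∀ v : ℝ, 0 < v → k * (1 + v) ≤ g - σ + g * v := by
    intro g hg v hv
    have hg : σ + k < g := hg
    nlinarith
  have hbound_int := integrableOn_Ioi_rpow_mul_one_add_rpow ha
  have hmeas : ∀ (p g : ℝ), Measurable
      (fun v : ℝ => (g - σ + g * v) ^ p / √(v * (v + 2))) := by
    intro p g; fun_prop
  refine (hasDerivAt_integral_of_dominated_loc_of_deriv_le
    (μ := volume.restrict (Ioi (0 : ℝ))) (x₀ := f) (s := Ioi (σ + k))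
    (F := fun g v => (g - σ + g * v) ^ (-a) / √(v * (v + 2)))
    (F' := fun g v => -a * ((1 + v) * (g - σ + g * v) ^ (-(a + 1)) / √(v * (v + 2))))
    (bound := fun v => a * k ^ (-(a + 1)) *
      (v ^ (-(1 / 2) : ℝ) * (1 + v) ^ (-(a + 1 / 2))))
    hs (Eventually.of_forall fun g => (hmeas _ g).aestronglyMeasurable) ?_ ?_ ?_ ?_ ?_).2
  · refine Integrable.mono' (hbound_int.const_mul (k ^ (-a))) (hmeas _ f).aestronglyMeasurable ?_
    refine (ae_restrict_iff' measurableSet_Ioi).2 (Eventually.of_forall fun v hv => ?_)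
    have hv : 0 < v := hv
    have h := hlow f (mem_of_mem_nhds hs) v hv
    have h0 : 0 < f - σ + f * v := lt_of_lt_of_le (by positivity) h
    rw [Real.norm_of_nonneg (by positivity)]
    exact rpow_neg_div_sqrt_le ha.le hk0 hv h
  · have : Measurable (fun v : ℝ =>
        -a * ((1 + v) * (f - σ + f * v) ^ (-(a + 1)) / √(v * (v + 2)))) := by fun_prop
    exact this.aestronglyMeasurable
  · refine (ae_restrict_iff' measurableSet_Ioi).2 (Eventually.of_forall fun v hv g hg => ?_)
    have hv : 0 < v := hv
    have h := hlow g hg v hv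
    have h0 : 0 < g - σ + g * v := lt_of_lt_of_le (by positivity) h
    rw [norm_mul, norm_neg, Real.norm_of_nonneg ha.le, Real.norm_of_nonneg (by positivity),
      mul_assoc]
    refine mul_le_mul_of_nonneg_left ?_ ha.le
    have h1 := rpow_neg_div_sqrt_le (p := a + 1) (by linarith) hk0 hv h
    have h2 : (1 + v) ^ (-(a + 1 / 2)) = (1 + v) * (1 + v) ^ (-(a + 1 + 1 / 2)) := by
      rw [← Real.rpow_one_add' (by positivity) (by linarith)]
      congr 1; ring
    rw [h2]
    calc (1 + v) * (g - σ + g * v) ^ (-(a + 1)) / √(v * (v + 2))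
        = (1 + v) * ((g - σ + g * v) ^ (-(a + 1)) / √(v * (v + 2))) := by ring
      _ ≤ (1 + v) * (k ^ (-(a + 1)) *
            (v ^ (-(1 / 2) : ℝ) * (1 + v) ^ (-(a + 1 + 1 / 2)))) := by gcongr
      _ = _ := by ring
  · exact hbound_int.const_mul _
  · refine (ae_restrict_iff' measurableSet_Ioi).2 (Eventually.of_forall fun v hv g hg => ?_)
    have hv : 0 < v := hv
    have h0 : 0 < g - σ + g * v := lt_of_lt_of_le (by positivity) (hlow g hg v hv)
    have h1 : HasDerivAt (fun g : ℝ => g - σ + g * v) (1 + v) g := by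
      exact (((hasDerivAt_id g).sub_const σ).add ((hasDerivAt_id g).mul_const v)).congr_deriv
        (by simp)
    have h2 := (h1.rpow_const (p := -a) (Or.inl h0.ne')).div_const (√(v * (v + 2)))
    refine h2.congr_deriv ?_
    rw [show -a - 1 = -(a + 1) by ring]
    ring

theorem G15_hasDerivAt {σ c n f : ℝ} (hσ : 0 < σ) (hc : 0 < c) (hn : 0 < n) (hf : σ < f) :
    HasDerivAt (G15 σ c n) (c ^ (1 / n) * ∫ v in Ioi (0 : ℝ),
      -(1 / n) * ((1 + v) * (f - σ + f * v) ^ (-(1 / n + 1)) / √(v * (v + 2)))) f := by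
  refine ((hasDerivAt_integral_shifted_rpow hσ (one_div_pos.2 hn) hf).const_mul
    (c ^ (1 / n))).congr_of_eventuallyEq ?_
  filter_upwards [Ioi_mem_nhds hf] with g hg
  exact G15_eq hσ hc hg

theorem integral_shifted_rpow_scale {σ a f : ℝ} (hσ : 0 < σ) (hf : σ < f) :
    √f * ∫ v in Ioi (0 : ℝ), (1 + v) * (f - σ + f * v) ^ (-(a + 1)) / √(v * (v + 2)) =
      (f - σ) ^ (-(1 / 2 + a)) * ∫ t in Ioi (0 : ℝ),
        t ^ (-(1 / 2) : ℝ) * (1 + t) ^ (-(a + 1)) *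
          ((1 + (f - σ) / f * t) / √(2 + (f - σ) / f * t)) := by
  have hf0 : 0 < f := hσ.trans hf
  have hε : 0 < f - σ := sub_pos.2 hf
  set ρ := (f - σ) / f with hρ
  have hρ0 : 0 < ρ := div_pos hε hf0
  have hfρ : f * ρ = f - σ := by rw [hρ]; field_simp
  have h := integral_comp_mul_left_Ioi'
    (fun v : ℝ => (1 + v) * (f - σ + f * v) ^ (-(a + 1)) / √(v * (v + 2))) 0 hρ0
  rw [mul_zero] at h
  rw [← h, smul_eq_mul, ← integral_const_mul, ← integral_const_mul, ← integral_const_mul]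
  refine setIntegral_congr_fun measurableSet_Ioi fun t ht => ?_
  have ht : 0 < t := ht
  have h1 : f - σ + f * (ρ * t) = (f - σ) * (1 + t) := by rw [← mul_assoc, hfρ]; ring
  have h2 : ρ * t * (ρ * t + 2) = ρ * (t * (2 + ρ * t)) := by ring
  have h3 : √f * ρ / √ρ = √(f - σ) := by
    rw [mul_div_assoc, Real.div_sqrt, ← Real.sqrt_mul hf0.le, hfρ]
  have h4 : (f - σ) ^ (-(1 / 2 + a)) = √(f - σ) * (f - σ) ^ (-(a + 1)) := by
    rw [Real.sqrt_eq_rpow, ← Real.rpow_add hε]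
    congr 1; ring
  have h5 : t ^ (-(1 / 2) : ℝ) = (√t)⁻¹ := by
    rw [Real.rpow_neg ht.le, Real.sqrt_eq_rpow]
  rw [h1, h2, h4, h5, ← h3, Real.sqrt_mul hρ0.le, Real.sqrt_mul ht.le,
    Real.mul_rpow hε.le (by positivity)]
  have h6 : 0 < √ρ := by positivity
  have h7 : 0 < √t := by positivity
  have h8 : 0 < √(2 + ρ * t) := by positivity
  field_simp

theorem Φ15_eq {σ c n f : ℝ} (hσ : 0 < σ) (hc : 0 < c) (hn : 0 < n) (hf : σ < f) :
    Φ15 σ c n f = (f - σ) ^ (-(1 / 2 + 1 / n)) * (c ^ (1 / n) / (n * Real.pi) *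
      ∫ t in Ioi (0 : ℝ), t ^ (-(1 / 2) : ℝ) * (1 + t) ^ (-(1 / n + 1)) *
          ((1 + (f - σ) / f * t) / √(2 + (f - σ) / f * t))) := by
  have h := integral_shifted_rpow_scale (a := 1 / n) hσ hf
  rw [Φ15, (G15_hasDerivAt hσ hc hn hf).deriv, integral_const_mul]
  rw [mul_left_comm ((f - σ) ^ (-(1 / 2 + 1 / n))), ← h]
  generalize ∫ v in Ioi (0 : ℝ),
    (1 + v) * (f - σ + f * v) ^ (-(1 / n + 1)) / √(v * (v + 2)) = I
  have := Real.pi_pos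
  field_simp

theorem tendsto_integral_rpow_mul_one_add_rpow {a : ℝ} (ha : 0 < a) :
    Tendsto (fun ρ : ℝ => ∫ t in Ioi (0 : ℝ), t ^ (-(1 / 2) : ℝ) * (1 + t) ^ (-(a + 1)) *
          ((1 + ρ * t) / √(2 + ρ * t))) (𝓝[>] 0)
      (𝓝 ((∫ t in Ioi (0 : ℝ), t ^ (-(1 / 2) : ℝ) * (1 + t) ^ (-(a + 1))) / √2)) := by
  rw [← integral_div]
  refine tendsto_integral_filter_of_dominated_convergence
    (fun t : ℝ => t ^ (-(1 / 2) : ℝ) * (1 + t) ^ (-(a + 1 / 2))) ?_ ?_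
    (integrableOn_Ioi_rpow_mul_one_add_rpow ha) ?_
  · refine Eventually.of_forall fun ρ => ?_
    have : Measurable (fun t : ℝ => t ^ (-(1 / 2) : ℝ) * (1 + t) ^ (-(a + 1)) *
          ((1 + ρ * t) / √(2 + ρ * t))) := by fun_prop
    exact this.aestronglyMeasurable
  · filter_upwards [Ioo_mem_nhdsGT (zero_lt_one' ℝ)] with ρ hρ
    refine (ae_restrict_iff' measurableSet_Ioi).2 (Eventually.of_forall fun t ht => ?_)
    have ht : 0 < t := ht
    have hρ0 : 0 < ρ := hρ.1
    rw [Real.norm_of_nonneg (by positivity)]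
    have h1 : (1 + ρ * t) / √(2 + ρ * t) ≤ (1 + t) ^ (1 / 2 : ℝ) := by
      rw [← Real.sqrt_eq_rpow]
      calc (1 + ρ * t) / √(2 + ρ * t) ≤ (1 + ρ * t) / √(1 + ρ * t) := by
            gcongr; norm_num
        _ = √(1 + ρ * t) := Real.div_sqrt
        _ ≤ √(1 + t) := by
            gcongr
            exact mul_le_of_le_one_left ht.le hρ.2.le
    have h2 : -(a + 1 / 2) = -(a + 1) + 1 / 2 := by ring
    rw [h2, Real.rpow_add (by positivity), ← mul_assoc]
    gcongr
  · refine (ae_restrict_iff' measurableSet_Ioi).2 (Eventually.of_forall fun t ht => ?_)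
    have hcont : ContinuousAt (fun ρ : ℝ => t ^ (-(1 / 2) : ℝ) * (1 + t) ^ (-(a + 1)) *
          ((1 + ρ * t) / √(2 + ρ * t))) 0 := by
      have h0 : √(2 + 0 * t) ≠ 0 := by simp
      fun_prop (disch := assumption)
    have h := hcont.tendsto.mono_left (nhdsWithin_le_nhds (s := Ioi 0))
    simpa [div_eq_mul_inv] using h

/-- Main asymptotic estimate of the confinement theorem: for the confining potential data
`R(f₀) = ((f₀ − σ̃)/c̃)^(−1/n)`, the quantity `Φ f = −(1/π)·√f·(d/df)∫_f^∞ R(f₀)/√(f₀² − f²) df₀`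
is well defined for `f > σ̃`, and
`lim_{f → σ̃⁺} (f − σ̃)^(1/2 + 1/n)·Φ f = (c̃^(1/n)/(n√(2π)))·Γ(1/2 + 1/n)/Γ(1 + 1/n)`;
in particular `Φ f → +∞` as `f → σ̃⁺`. -/
theorem stmt_15 (σ c n : ℝ) (hσ : 0 < σ) (hc : 0 < c) (hn : 0 < n) :
    (∀ f : ℝ, σ < f → DifferentiableAt ℝ (G15 σ c n) f) ∧
    Filter.Tendsto (fun f : ℝ => (f - σ) ^ (1 / 2 + 1 / n : ℝ) * Φ15 σ c n f)
      (nhdsWithin σ (Set.Ioi σ))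
      (nhds (c ^ (1 / n : ℝ) / (n * Real.sqrt (2 * Real.pi)) *
        (Real.Gamma (1 / 2 + 1 / n) / Real.Gamma (1 + 1 / n)))) ∧
    Filter.Tendsto (Φ15 σ c n) (nhdsWithin σ (Set.Ioi σ)) Filter.atTop := by
  have ha : 0 < 1 / n := one_div_pos.2 hn
  have hlim : Tendsto (fun f : ℝ => (f - σ) ^ (1 / 2 + 1 / n : ℝ) * Φ15 σ c n f) (𝓝[>] σ)
      (𝓝 (c ^ (1 / n : ℝ) / (n * Real.sqrt (2 * Real.pi)) *
        (Real.Gamma (1 / 2 + 1 / n) / Real.Gamma (1 + 1 / n)))) := by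
    have hρ : Tendsto (fun f : ℝ => (f - σ) / f) (𝓝[>] σ) (𝓝[>] 0) := by
      refine tendsto_nhdsWithin_iff.2 ⟨?_, ?_⟩
      · have hcont : ContinuousAt (fun f : ℝ => (f - σ) / f) σ := by
          have := hσ.ne'
          fun_prop (disch := assumption)
        simpa using hcont.tendsto.mono_left (nhdsWithin_le_nhds (s := Ioi σ))
      · filter_upwards [self_mem_nhdsWithin] with f hf
        have hf : σ < f := hf
        exact div_pos (sub_pos.2 hf) (hσ.trans hf)
    have h := ((tendsto_integral_rpow_mul_one_add_rpow ha).comp hρ).const_mul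
      (c ^ (1 / n) / (n * Real.pi))
    have hbeta := integral_Ioi_rpow_mul_one_add_rpow (s := 1 / 2) (r := 1 / 2 + 1 / n)
      (by norm_num) (by positivity)
    rw [show (1 / 2 : ℝ) - 1 = -(1 / 2) by norm_num,
      show (1 / 2 : ℝ) + (1 / 2 + 1 / n) = 1 / n + 1 by ring] at hbeta
    rw [hbeta, Real.Gamma_one_half_eq] at h
    have hval : c ^ (1 / n : ℝ) / (n * √(2 * Real.pi)) *
        (Real.Gamma (1 / 2 + 1 / n) / Real.Gamma (1 + 1 / n)) =
        c ^ (1 / n) / (n * Real.pi) *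
          (√Real.pi * Real.Gamma (1 / 2 + 1 / n) / Real.Gamma (1 / n + 1) / √2) := by
      rw [add_comm 1 (1 / n), Real.sqrt_mul (by norm_num)]
      have hG : 0 < Real.Gamma (1 / n + 1) := Real.Gamma_pos_of_pos (by positivity)
      have hpi := Real.pi_pos
      have hs : 0 < √Real.pi := Real.sqrt_pos.2 hpi
      have hs2 : √Real.pi * √Real.pi = Real.pi := Real.mul_self_sqrt hpi.le
      rw [show n * Real.pi = n * (√Real.pi * √Real.pi) by rw [hs2]]
      field_simp
    rw [hval]
    refine h.congr' ?_
    filter_upwards [self_mem_nhdsWithin] with f hf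
    have hf : σ < f := hf
    rw [Φ15_eq hσ hc hn hf, ← mul_assoc, ← Real.rpow_add (sub_pos.2 hf), add_neg_cancel,
      Real.rpow_zero, one_mul]
    rfl
  refine ⟨fun f hf => (G15_hasDerivAt hσ hc hn hf).differentiableAt, hlim, ?_⟩
  have hpos : 0 < c ^ (1 / n : ℝ) / (n * Real.sqrt (2 * Real.pi)) *
      (Real.Gamma (1 / 2 + 1 / n) / Real.Gamma (1 + 1 / n)) := by
    have h1 : 0 < Real.Gamma (1 / 2 + 1 / n) := Real.Gamma_pos_of_pos (by positivity)
    have h2 : 0 < Real.Gamma (1 + 1 / n) := Real.Gamma_pos_of_pos (by positivity)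
    have := Real.pi_pos
    positivity
  have htop : Tendsto (fun f : ℝ => (f - σ) ^ (-(1 / 2 + 1 / n : ℝ))) (𝓝[>] σ) atTop := by
    have hsub : Tendsto (fun f : ℝ => f - σ) (𝓝[>] σ) (𝓝[>] 0) := by
      refine tendsto_nhdsWithin_iff.2 ⟨?_, ?_⟩
      · have hcont : ContinuousAt (fun f : ℝ => f - σ) σ := by fun_prop
        simpa using hcont.tendsto.mono_left (nhdsWithin_le_nhds (s := Ioi σ))
      · filter_upwards [self_mem_nhdsWithin] with f hf
        have hf : σ < f := hf
        exact sub_pos.2 hf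
    exact (tendsto_rpow_neg_nhdsGT_zero (by linarith)).comp hsub
  refine (htop.atTop_mul_pos hpos hlim).congr' ?_
  filter_upwards [self_mem_nhdsWithin] with f hf
  have hf : σ < f := hf
  rw [← mul_assoc, ← Real.rpow_add (sub_pos.2 hf), neg_add_cancel, Real.rpow_zero, one_mul]
end

section
/- Let σ̃ > 0, c̃ > 0 and n > 0 be real, define R(f₀) := ((f₀ − σ̃)/c̃)^{−1/n} for f₀ > σ̃, and define Φ(f) := −(1/π)·√f·(d/df) ∫_f^∞ R(f₀)/√(f₀² − f²) df₀ for f > σ̃. Then the improper integral ∫_{σ̃}^{σ̃+1} Φ(f) df converges if and only if n > 2. Equivalently: the radial coordinate η(f) := ∫_{σ̃+1}^f Φ(u) du tends to a finite limit as f → σ̃⁺ when n > 2, and tends to −∞ as f → σ̃⁺ when 0 < n ≤ 2. -/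
open MeasureTheory

/-- `G16 σ c n f = ∫_f^∞ R(f₀)/√(f₀² − f²) df₀` with `R(f₀) = ((f₀ − σ)/c)^(−1/n)`. -/
noncomputable def G16 (σ c n : ℝ) (f : ℝ) : ℝ :=
  ∫ f₀ in Set.Ioi f, ((f₀ - σ) / c) ^ (-(1 : ℝ) / n) / Real.sqrt (f₀ ^ 2 - f ^ 2)

/-- `Φ16 σ c n f = −(1/π)·√f·(d/df) G16 σ c n f`. -/
noncomputable def Φ16 (σ c n : ℝ) (f : ℝ) : ℝ :=
  -(1 / Real.pi) * Real.sqrt f * deriv (G16 σ c n) f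

open Set Filter Topology

/-- The unit-scale form `∫_1^∞ (f t − σ)^(−a) / √(t² − 1) dt` of the integral transform. -/
noncomputable def scaledKernel (σ a f : ℝ) : ℝ :=
  ∫ t in Ioi (1 : ℝ), (f * t - σ) ^ (-a) / √(t ^ 2 - 1)

theorem measurable_kernel (σ a f : ℝ) :
    Measurable fun t : ℝ => (f * t - σ) ^ a / √(t ^ 2 - 1) := by
  fun_prop

theorem integrableOn_sub_one_rpow_neg_div_sqrt {b : ℝ} (hb : 0 < b) (hb' : b < 1 / 2) :
    IntegrableOn (fun t : ℝ => (t - 1) ^ (-b) / √(t ^ 2 - 1)) (Ioi 1) := by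
  have hmeas : Measurable fun t : ℝ => (t - 1) ^ (-b) / √(t ^ 2 - 1) := by fun_prop
  have near : IntegrableOn (fun t : ℝ => (t - 1) ^ (-b) / √(t ^ 2 - 1)) (Ioc 1 2) := by
    have h0 : IntegrableOn (fun t : ℝ => (t - 1) ^ (-b - 1 / 2)) (Ioc 1 2) := by
      have h := (intervalIntegral.intervalIntegrable_rpow' (a := 0) (b := 1)
        (r := -b - 1 / 2) (by linarith)).comp_sub_right 1
      norm_num at h
      rwa [intervalIntegrable_iff_integrableOn_Ioc_of_le (by norm_num)] at h
    refine Integrable.mono' h0 hmeas.aestronglyMeasurable ?_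
    refine (ae_restrict_iff' measurableSet_Ioc).2 (ae_of_all _ fun t ht => ?_)
    have ht1 : 0 < t - 1 := by linarith [ht.1]
    rw [Real.norm_of_nonneg (by positivity), Real.rpow_sub ht1, ← Real.sqrt_eq_rpow]
    gcongr
    nlinarith
  have far : IntegrableOn (fun t : ℝ => (t - 1) ^ (-b) / √(t ^ 2 - 1)) (Ioi 2) := by
    have h0 : IntegrableOn (fun t : ℝ => (t + -1) ^ (-b - 1)) (Ioi 2) :=
      integrableOn_add_rpow_Ioi_of_lt (by linarith) (by norm_num)
    refine Integrable.mono' h0 hmeas.aestronglyMeasurable ?_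
    refine (ae_restrict_iff' measurableSet_Ioi).2 (ae_of_all _ fun t ht => ?_)
    have ht1 : 0 < t - 1 := by linarith [mem_Ioi.1 ht]
    rw [← sub_eq_add_neg, Real.norm_of_nonneg (by positivity), Real.rpow_sub ht1, Real.rpow_one]
    gcongr
    apply Real.le_sqrt_of_sq_le
    nlinarith
  rw [← Ioc_union_Ioi_eq_Ioi (show (1 : ℝ) ≤ 2 by norm_num)]
  exact near.union far

theorem integrableOn_rpow_neg_div_sqrt {a : ℝ} (ha : 0 < a) :
    IntegrableOn (fun t : ℝ => t ^ (-a) / √(t ^ 2 - 1)) (Ioi 1) := by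
  have hb : 0 < min a (1 / 4) := lt_min ha (by norm_num)
  refine Integrable.mono' (integrableOn_sub_one_rpow_neg_div_sqrt hb
    ((min_le_right _ _).trans_lt (by norm_num)))
    (Measurable.aestronglyMeasurable (by fun_prop)) ?_
  refine (ae_restrict_iff' measurableSet_Ioi).2 (ae_of_all _ fun t ht => ?_)
  have ht1 : 1 < t := ht
  have ht0 : 0 < t - 1 := by linarith
  rw [Real.norm_of_nonneg (by positivity)]
  gcongr
  calc t ^ (-a) ≤ t ^ (-min a (1 / 4)) :=
        Real.rpow_le_rpow_of_exponent_le ht1.le (neg_le_neg (min_le_left _ _))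
    _ ≤ (t - 1) ^ (-min a (1 / 4)) :=
        Real.rpow_le_rpow_of_nonpos ht0 (by linarith) (by linarith)

section Kernel

variable {σ a f : ℝ}

theorem integrableOn_kernel (hσ : 0 < σ) (ha : 0 < a) (hf : σ < f) :
    IntegrableOn (fun t : ℝ => (f * t - σ) ^ (-a) / √(t ^ 2 - 1)) (Ioi 1) := by
  refine Integrable.mono' ((integrableOn_rpow_neg_div_sqrt ha).const_mul ((f - σ) ^ (-a)))
    (measurable_kernel σ (-a) f).aestronglyMeasurable ?_
  refine (ae_restrict_iff' measurableSet_Ioi).2 (ae_of_all _ fun t ht => ?_)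
  have ht1 : 1 < t := ht
  have hfσ : 0 < f - σ := by linarith
  have hle : (f - σ) * t ≤ f * t - σ := by nlinarith
  have hpos : 0 < (f - σ) * t := by positivity
  have hbase : 0 < f * t - σ := by linarith
  rw [Real.norm_of_nonneg (by positivity), ← mul_div_assoc,
    ← Real.mul_rpow hfσ.le (by linarith)]
  gcongr ?_ / _
  exact Real.rpow_le_rpow_of_nonpos hpos hle (by linarith)

theorem exists_hasDerivAt_scaledKernel (hσ : 0 < σ) (ha : 0 < a) (hf : σ < f) :
    ∃ d ≤ 0, HasDerivAt (scaledKernel σ a) d f := by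
  set m := (σ + f) / 2 with hm
  have hmσ : 0 < m - σ := by rw [hm]; linarith
  have key := hasDerivAt_integral_of_dominated_loc_of_deriv_le (𝕜 := ℝ)
    (μ := volume.restrict (Ioi (1 : ℝ))) (x₀ := f) (s := Ioi m)
    (F := fun x t => (x * t - σ) ^ (-a) / √(t ^ 2 - 1))
    (F' := fun x t => (t * (-a) * (x * t - σ) ^ (-a - 1)) / √(t ^ 2 - 1))
    (bound := fun t => a * (m - σ) ^ (-a - 1) * (t ^ (-a) / √(t ^ 2 - 1)))
    (Ioi_mem_nhds (by rw [hm]; linarith))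
    (Eventually.of_forall fun x => (measurable_kernel σ (-a) x).aestronglyMeasurable)
    (integrableOn_kernel hσ ha hf)
    (Measurable.aestronglyMeasurable (by fun_prop))
    ((ae_restrict_iff' measurableSet_Ioi).2 (ae_of_all _ fun t ht x hx => ?_))
    ((integrableOn_rpow_neg_div_sqrt ha).const_mul _)
    ((ae_restrict_iff' measurableSet_Ioi).2 (ae_of_all _ fun t ht x hx => ?_))
  · refine ⟨_, ?_, key.2⟩
    refine setIntegral_nonpos measurableSet_Ioi fun t ht => ?_
    have ht1 : 1 < t := ht
    have hbase : 0 < f * t - σ := by nlinarith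
    refine div_nonpos_of_nonpos_of_nonneg ?_ (Real.sqrt_nonneg _)
    exact mul_nonpos_of_nonpos_of_nonneg (by nlinarith) (by positivity)
  · have ht1 : 1 < t := ht
    have ht0 : 0 < t := by linarith
    have hx1 : m < x := hx
    have hle : (m - σ) * t ≤ x * t - σ := by nlinarith
    have hpos : 0 < (m - σ) * t := by positivity
    have hbase : 0 < x * t - σ := by linarith
    have hr := Real.rpow_le_rpow_of_nonpos hpos hle (show -a - 1 ≤ 0 by linarith)
    rw [Real.mul_rpow hmσ.le ht0.le] at hr
    have hta : t ^ (-a) = t * t ^ (-a - 1) := by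
      rw [Real.rpow_sub ht0, Real.rpow_one]; field_simp
    rw [norm_div, Real.norm_of_nonneg (Real.sqrt_nonneg _), norm_mul, norm_mul, norm_neg,
      Real.norm_of_nonneg ht0.le, Real.norm_of_nonneg ha.le,
      Real.norm_of_nonneg (by positivity), ← mul_div_assoc, hta]
    gcongr ?_ / _
    calc t * a * (x * t - σ) ^ (-a - 1)
        ≤ t * a * ((m - σ) ^ (-a - 1) * t ^ (-a - 1)) := by gcongr
      _ = _ := by ring
  · have ht1 : 1 < t := ht
    have hx1 : m < x := hx
    have hbase : 0 < x * t - σ := by nlinarith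
    refine HasDerivAt.div_const ?_ _
    have h1 : HasDerivAt (fun x : ℝ => x * t - σ) t x := by
      simpa using ((hasDerivAt_id x).mul_const t).sub_const σ
    exact h1.rpow_const (Or.inl hbase.ne')

theorem differentiableAt_scaledKernel (hσ : 0 < σ) (ha : 0 < a) (hf : σ < f) :
    DifferentiableAt ℝ (scaledKernel σ a) f :=
  let ⟨_, _, h⟩ := exists_hasDerivAt_scaledKernel hσ ha hf
  h.differentiableAt

theorem deriv_scaledKernel_nonpos (hσ : 0 < σ) (ha : 0 < a) (hf : σ < f) :
    deriv (scaledKernel σ a) f ≤ 0 := by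
  obtain ⟨d, hd, h⟩ := exists_hasDerivAt_scaledKernel hσ ha hf
  rwa [h.deriv]

theorem continuousOn_scaledKernel (hσ : 0 < σ) (ha : 0 < a) (ha' : a < 1 / 2) :
    ContinuousOn (scaledKernel σ a) (Ici σ) := by
  refine continuousOn_of_dominated
    (bound := fun t => σ ^ (-a) * ((t - 1) ^ (-a) / √(t ^ 2 - 1)))
    (fun x _ => (measurable_kernel σ (-a) x).aestronglyMeasurable)
    (fun x hx => (ae_restrict_iff' measurableSet_Ioi).2 (ae_of_all _ fun t ht => ?_))
    ((integrableOn_sub_one_rpow_neg_div_sqrt ha ha').const_mul _)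
    ((ae_restrict_iff' measurableSet_Ioi).2 (ae_of_all _ fun t ht => ?_))
  · have ht1 : 0 < t - 1 := by linarith [mem_Ioi.1 ht]
    have hx1 : σ ≤ x := hx
    have hle : σ * (t - 1) ≤ x * t - σ := by nlinarith
    have hpos : 0 < σ * (t - 1) := by positivity
    have hbase : 0 < x * t - σ := by linarith
    rw [Real.norm_of_nonneg (by positivity), ← mul_div_assoc, ← Real.mul_rpow hσ.le ht1.le]
    gcongr ?_ / _
    exact Real.rpow_le_rpow_of_nonpos hpos hle (by linarith)
  · refine ContinuousOn.div_const (ContinuousOn.rpow_const (by fun_prop) fun x hx => Or.inl ?_) _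
    have ht1 : 1 < t := ht
    have hx1 : σ ≤ x := hx
    have hbase : 0 < x * t - σ := by nlinarith
    exact hbase.ne'

theorem log_le_scaledKernel (hσ : 0 < σ) (ha : 1 / 2 ≤ a) (hf : σ < f) (hf' : f < σ + 1) :
    (σ + 2) ^ (-a) / √3 * Real.log (1 / (f - σ)) ≤ scaledKernel σ a f := by
  have hε : 0 < f - σ := by linarith
  have hle : 1 + (f - σ) ≤ 2 := by linarith
  have hint := integrableOn_kernel hσ (by linarith : 0 < a) hf
  have hsub : Ioc (1 + (f - σ)) 2 ⊆ Ioi 1 := fun t ht => by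
    have := ht.1
    simp only [mem_Ioi]; linarith
  have hlog : ∫ t in (1 + (f - σ))..2, (σ + 2) ^ (-a) / √3 * (t - 1)⁻¹ =
      (σ + 2) ^ (-a) / √3 * Real.log (1 / (f - σ)) := by
    rw [intervalIntegral.integral_const_mul,
      intervalIntegral.integral_comp_sub_right (fun t : ℝ => t⁻¹) 1,
      integral_inv_of_pos (by linarith) (by norm_num)]
    norm_num
  rw [← hlog]
  calc ∫ t in (1 + (f - σ))..2, (σ + 2) ^ (-a) / √3 * (t - 1)⁻¹
      ≤ ∫ t in (1 + (f - σ))..2, (f * t - σ) ^ (-a) / √(t ^ 2 - 1) := by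
        refine intervalIntegral.integral_mono_on hle ?_ ?_ fun t ht => ?_
        · refine ContinuousOn.intervalIntegrable ?_
          rw [uIcc_of_le hle]
          refine continuousOn_const.mul (ContinuousOn.inv₀ (by fun_prop) fun t ht => ?_)
          have := ht.1
          exact (by linarith : 0 < t - 1).ne'
        · rw [intervalIntegrable_iff_integrableOn_Ioc_of_le hle]
          exact hint.mono_set hsub
        · obtain ⟨hs, hs'⟩ := ht
          have hs0 : 0 < t - 1 := by linarith
          have hub : f * t - σ ≤ (σ + 2) * (t - 1) := by nlinarith
          have hbase : 0 < f * t - σ := by nlinarith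
          have h1 : (σ + 2) ^ (-a) * (t - 1) ^ (-(1 / 2) : ℝ) ≤ (f * t - σ) ^ (-a) :=
            calc (σ + 2) ^ (-a) * (t - 1) ^ (-(1 / 2) : ℝ)
                ≤ (σ + 2) ^ (-a) * (t - 1) ^ (-a) := by
                  gcongr ?_ * ?_
                  exact Real.rpow_le_rpow_of_exponent_ge hs0 (by linarith) (by linarith)
              _ = ((σ + 2) * (t - 1)) ^ (-a) := (Real.mul_rpow (by linarith) hs0.le).symm
              _ ≤ _ := Real.rpow_le_rpow_of_nonpos hbase hub (by linarith)
          have h2 : √(t ^ 2 - 1) ≤ √3 * √(t - 1) := by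
            rw [← Real.sqrt_mul (by norm_num)]
            exact Real.sqrt_le_sqrt (by nlinarith)
          have h3 : 0 < √(t ^ 2 - 1) := Real.sqrt_pos.2 (by nlinarith)
          calc (σ + 2) ^ (-a) / √3 * (t - 1)⁻¹
              = ((σ + 2) ^ (-a) * (t - 1) ^ (-(1 / 2) : ℝ)) / (√3 * √(t - 1)) := by
                rw [Real.rpow_neg hs0.le, ← Real.sqrt_eq_rpow]
                have h4 : √(t - 1) * √(t - 1) = t - 1 := Real.mul_self_sqrt hs0.le
                have h5 : 0 < √(t - 1) := Real.sqrt_pos.2 hs0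
                rw [show (t - 1)⁻¹ = (√(t - 1))⁻¹ * (√(t - 1))⁻¹ by rw [← mul_inv, h4]]
                field_simp
            _ ≤ _ := by gcongr
    _ = ∫ t in Ioc (1 + (f - σ)) 2, (f * t - σ) ^ (-a) / √(t ^ 2 - 1) :=
        intervalIntegral.integral_of_le hle
    _ ≤ scaledKernel σ a f := by
        refine setIntegral_mono_set hint ?_ hsub.eventuallyLE
        refine (ae_restrict_iff' measurableSet_Ioi).2 (ae_of_all _ fun t ht => ?_)
        have ht1 : 1 < t := ht
        have hbase : 0 < f * t - σ := by nlinarith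
        simp only [Pi.zero_apply]
        positivity

theorem tendsto_scaledKernel_atTop (hσ : 0 < σ) (ha : 1 / 2 ≤ a) :
    Tendsto (scaledKernel σ a) (𝓝[>] σ) atTop := by
  have hmem : Ioo σ (σ + 1) ∈ 𝓝[>] σ := Ioo_mem_nhdsGT (by linarith)
  have hC : 0 < (σ + 2) ^ (-a) / √3 := by positivity
  refine tendsto_atTop_mono' _ (eventually_of_mem hmem fun f hf =>
    log_le_scaledKernel hσ ha hf.1 hf.2) ?_
  refine Tendsto.const_mul_atTop hC (Real.tendsto_log_atTop.comp ?_)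
  have h0 : Tendsto (fun f : ℝ => f - σ) (𝓝[>] σ) (𝓝[>] 0) := by
    refine tendsto_nhdsWithin_iff.2 ⟨?_, eventually_of_mem self_mem_nhdsWithin fun f hf => ?_⟩
    · have : Tendsto (fun f : ℝ => f - σ) (𝓝 σ) (𝓝 (σ - σ)) :=
        (continuous_id.sub continuous_const).tendsto σ
      rw [sub_self] at this
      exact this.mono_left nhdsWithin_le_nhds
    · exact sub_pos.2 (mem_Ioi.1 hf)
  simpa only [one_div, Function.comp_def] using tendsto_inv_nhdsGT_zero.comp h0

end Kernel

section Metric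

variable {σ c n f : ℝ}

theorem G16_eq_scaledKernel (hσ : 0 < σ) (hc : 0 < c) (hf : σ < f) :
    G16 σ c n f = c ^ (1 / n) * scaledKernel σ (1 / n) f := by
  have hf0 : 0 < f := by linarith
  have h := integral_comp_mul_left_Ioi
    (fun x => ((x - σ) / c) ^ (-(1 : ℝ) / n) / √(x ^ 2 - f ^ 2)) 1 hf0
  rw [mul_one, smul_eq_mul, eq_inv_mul_iff_mul_eq₀ hf0.ne', ← integral_const_mul] at h
  rw [G16, ← h, scaledKernel, ← integral_const_mul]
  refine setIntegral_congr_fun measurableSet_Ioi fun t ht => ?_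
  have ht1 : 1 < t := ht
  have hbase : 0 < f * t - σ := by nlinarith
  have h3 : 0 < √(t ^ 2 - 1) := Real.sqrt_pos.2 (by nlinarith)
  have h4 : √((f * t) ^ 2 - f ^ 2) = f * √(t ^ 2 - 1) := by
    rw [show (f * t) ^ 2 - f ^ 2 = f ^ 2 * (t ^ 2 - 1) by ring, Real.sqrt_mul (by positivity),
      Real.sqrt_sq hf0.le]
  have h5 : 0 < c ^ (1 / n) := by positivity
  rw [h4, Real.div_rpow hbase.le hc.le, neg_div, Real.rpow_neg hc.le]
  field_simp

theorem Φ16_eq (hσ : 0 < σ) (hc : 0 < c) (hf : σ < f) :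
    Φ16 σ c n f =
      c ^ (1 / n) / Real.pi * (√f * -deriv (scaledKernel σ (1 / n)) f) := by
  have h : G16 σ c n =ᶠ[𝓝 f] fun x => c ^ (1 / n) * scaledKernel σ (1 / n) x :=
    eventually_of_mem (Ioi_mem_nhds hf) fun x hx => G16_eq_scaledKernel hσ hc hx
  rw [Φ16, h.deriv_eq, deriv_const_mul_field]
  ring

theorem integrableOn_Φ16 (hσ : 0 < σ) (hc : 0 < c) {x y : ℝ} (hx : σ ≤ x)
    (h : IntegrableOn (fun u => -deriv (scaledKernel σ (1 / n)) u) (Ioc x y)) :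
    IntegrableOn (Φ16 σ c n) (Ioc x y) := by
  have hmul : IntegrableOn (fun u => √u * -deriv (scaledKernel σ (1 / n)) u) (Ioc x y) := by
    refine Integrable.bdd_mul (c := √y) h (by fun_prop) ?_
    refine (ae_restrict_iff' measurableSet_Ioc).2 (ae_of_all _ fun t ht => ?_)
    rw [Real.norm_of_nonneg (Real.sqrt_nonneg _)]
    exact Real.sqrt_le_sqrt ht.2
  refine IntegrableOn.congr_fun (hmul.const_mul (c ^ (1 / n) / Real.pi)) (fun u hu => ?_)
    measurableSet_Ioc
  exact (Φ16_eq hσ hc (hx.trans_lt hu.1)).symm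

theorem integrableOn_neg_deriv_scaledKernel {a x y : ℝ} (hσ : 0 < σ) (ha : 0 < a) (hx : σ ≤ x)
    (hcont : ContinuousOn (scaledKernel σ a) (Icc x y)) :
    IntegrableOn (fun u => -deriv (scaledKernel σ a) u) (Ioc x y) :=
  intervalIntegral.integrableOn_deriv_of_nonneg hcont.neg
    (fun _ hu => (differentiableAt_scaledKernel hσ ha (hx.trans_lt hu.1)).hasDerivAt.neg)
    (fun _ hu => neg_nonneg.2 (deriv_scaledKernel_nonpos hσ ha (hx.trans_lt hu.1)))

theorem integrableOn_Φ16_of_two_lt (hσ : 0 < σ) (hc : 0 < c) (hn : 2 < n) :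
    IntegrableOn (Φ16 σ c n) (Ioc σ (σ + 1)) := by
  have ha : 0 < 1 / n := by positivity
  have ha' : 1 / n < 1 / 2 := one_div_lt_one_div_of_lt (by norm_num) hn
  exact integrableOn_Φ16 hσ hc le_rfl (integrableOn_neg_deriv_scaledKernel hσ ha le_rfl
    ((continuousOn_scaledKernel hσ ha ha').mono Icc_subset_Ici_self))

theorem tendsto_intervalIntegral_of_integrableOn {g : ℝ → ℝ} {x y : ℝ} (hxy : x < y)
    (h : IntegrableOn g (Ioc x y)) :
    Tendsto (fun f : ℝ => ∫ u in y..f, g u) (𝓝[>] x) (𝓝 (∫ u in y..x, g u)) := by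
  have hi : IntervalIntegrable g volume x y :=
    (intervalIntegrable_iff_integrableOn_Ioc_of_le hxy.le).2 h
  have hcont := intervalIntegral.continuousOn_primitive_interval' hi right_mem_uIcc
  rw [uIcc_of_le hxy.le] at hcont
  have := hcont x (left_mem_Icc.2 hxy.le)
  exact this.mono_left (nhdsWithin_le_iff.2 (Icc_mem_nhdsGT hxy))

theorem intervalIntegral_Φ16_le (hσ : 0 < σ) (hc : 0 < c) (hn : 0 < n) {y : ℝ} (hf : σ < f)
    (hfy : f ≤ y) :
    ∫ u in y..f, Φ16 σ c n u ≤ c ^ (1 / n) / Real.pi * √σ *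
      (scaledKernel σ (1 / n) y - scaledKernel σ (1 / n) f) := by
  have ha : 0 < 1 / n := by positivity
  have hderiv : ∀ u ∈ Icc f y, HasDerivAt (scaledKernel σ (1 / n))
      (deriv (scaledKernel σ (1 / n)) u) u := fun u hu =>
    (differentiableAt_scaledKernel hσ ha (hf.trans_le hu.1)).hasDerivAt
  have hK := integrableOn_neg_deriv_scaledKernel hσ ha hf.le
    (fun u hu => (hderiv u hu).continuousAt.continuousWithinAt)
  have hΦ := integrableOn_Φ16 hσ hc hf.le hK
  rw [← intervalIntegrable_iff_integrableOn_Ioc_of_le hfy] at hK hΦ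
  have hFTC : ∫ u in f..y, -deriv (scaledKernel σ (1 / n)) u =
      -scaledKernel σ (1 / n) y - -scaledKernel σ (1 / n) f :=
    intervalIntegral.integral_eq_sub_of_hasDerivAt
      (fun u hu => (hderiv u (by rwa [uIcc_of_le hfy] at hu)).neg) hK
  have hmono := intervalIntegral.integral_mono_on hfy
    (hK.const_mul (c ^ (1 / n) / Real.pi * √σ)) hΦ (fun u hu => by
      have hu' : σ < u := hf.trans_le hu.1
      have hd := neg_nonneg.2 (deriv_scaledKernel_nonpos hσ ha hu')
      have hpi := Real.pi_pos
      rw [Φ16_eq hσ hc hu', mul_assoc]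
      gcongr)
  rw [intervalIntegral.integral_const_mul, hFTC] at hmono
  rw [intervalIntegral.integral_symm]
  linarith

theorem tendsto_intervalIntegral_Φ16_atBot (hσ : 0 < σ) (hc : 0 < c) (hn : 0 < n) (hn' : n ≤ 2) :
    Tendsto (fun f : ℝ => ∫ u in (σ + 1)..f, Φ16 σ c n u) (𝓝[>] σ) atBot := by
  have hmem : Ioo σ (σ + 1) ∈ 𝓝[>] σ := Ioo_mem_nhdsGT (by linarith)
  refine tendsto_atBot_mono' _ (eventually_of_mem hmem fun f hf =>
    intervalIntegral_Φ16_le hσ hc hn hf.1 hf.2.le) ?_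
  have hpi := Real.pi_pos
  refine Tendsto.const_mul_atBot (by positivity) ?_
  simp only [sub_eq_add_neg]
  exact tendsto_atBot_add_const_left _ _ (tendsto_neg_atTop_atBot.comp
    (tendsto_scaledKernel_atTop hσ (one_div_le_one_div_of_le hn hn')))

end Metric

/-- Location of the IR bottom: for the confining potential data
`R(f₀) = ((f₀ − σ̃)/c̃)^(−1/n)` and `Φ` as in the bulk-building formula, the improper integral
`∫_{σ̃}^{σ̃+1} Φ(f) df` converges iff `n > 2`; equivalently `η(f) = ∫_{σ̃+1}^f Φ(u) du` tends
to a finite limit as `f → σ̃⁺` when `n > 2`, and tends to `−∞` when `0 < n ≤ 2`. -/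
theorem stmt_16 (σ c n : ℝ) (hσ : 0 < σ) (hc : 0 < c) (hn : 0 < n) :
    (IntegrableOn (Φ16 σ c n) (Set.Ioo σ (σ + 1)) ↔ 2 < n) ∧
    (2 < n → ∃ l : ℝ,
      Filter.Tendsto (fun f : ℝ => ∫ u in (σ + 1)..f, Φ16 σ c n u)
        (nhdsWithin σ (Set.Ioi σ)) (nhds l)) ∧
    (n ≤ 2 →
      Filter.Tendsto (fun f : ℝ => ∫ u in (σ + 1)..f, Φ16 σ c n u)
        (nhdsWithin σ (Set.Ioi σ)) Filter.atBot) := by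
  have hlim : 2 < n → ∃ l : ℝ, Filter.Tendsto (fun f : ℝ => ∫ u in (σ + 1)..f, Φ16 σ c n u)
      (nhdsWithin σ (Set.Ioi σ)) (nhds l) := fun h =>
    ⟨_, tendsto_intervalIntegral_of_integrableOn (by linarith)
      (integrableOn_Φ16_of_two_lt hσ hc h)⟩
  have hbot := tendsto_intervalIntegral_Φ16_atBot hσ hc hn
  refine ⟨⟨fun h => ?_, fun h => ?_⟩, hlim, hbot⟩
  · by_contra! hn'
    rw [← integrableOn_Ioc_iff_integrableOn_Ioo] at h
    exact not_tendsto_nhds_of_tendsto_atBot (hbot hn') _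
      (tendsto_intervalIntegral_of_integrableOn (by linarith) h)
  · exact (integrableOn_Φ16_of_two_lt hσ hc h).mono_set Set.Ioo_subset_Ioc_self
end
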